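/- arXiv:2109.11575 — 5 statements merged into one kernel-verified Lean document; each statement's English description precedes it below -/
import Mathlib

section
/- Let f : S^m → ℝ^d be a continuous map with m > d. Then there exist points p₁, p₂ ∈ S^m with p₁ ≠ p₂ and p₁ ≠ -p₂ such that f(p₁) = f(p₂). -/
open Polynomial in
lemma det_interp {m : ℕ} (A : EuclideanSpace ℝ (Fin m) →L[ℝ] EuclideanSpace ℝ (Fin m))
    (v : ℕ → ℝ) (hv : Function.Injective v) (t : ℝ) :
    (1 + t • A).det = ∑ i ∈ Finset.range (m+1),
      (1 + v i • A).det * (Lagrange.basis (Finset.range (m+1)) v i).eval t := by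
  let b := (EuclideanSpace.basisFun (Fin m) ℝ).toBasis
  let M := LinearMap.toMatrix b b A.toLinearMap
  let p : ℝ[X] := Matrix.det ((X : ℝ[X]) • M.map C + (1 : Matrix (Fin m) (Fin m) ℝ).map C)
  have hp : ∀ s : ℝ, p.eval s = (1 + s • A).det := by
    intro s
    have h1 : (1 + s • A).det = Matrix.det (1 + s • M) := by
      rw [ContinuousLinearMap.det, ← LinearMap.det_toMatrix b]
      congr 1
      simp [M, LinearMap.toMatrix_one]
    rw [h1]
    simp only [p]
    rw [← Polynomial.coe_evalRingHom, RingHom.map_det]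
    congr 1
    ext i j
    by_cases hij : i = j
    · subst hij; simp; ring
    · simp [hij]; ring
  have hdeg : p.degree < (Finset.range (m+1)).card := by
    have := natDegree_det_X_add_C_le M 1
    rw [Fintype.card_fin] at this
    refine lt_of_le_of_lt (Polynomial.degree_le_natDegree) ?_
    simp only [Finset.card_range]
    exact_mod_cast Nat.lt_succ_of_le this
  have h := Lagrange.eq_interpolate (v := v) (s := Finset.range (m+1)) hv.injOn hdeg
  rw [← hp t]
  conv_lhs => rw [h]
  rw [Lagrange.interpolate_apply, Polynomial.eval_finsetSum]
  refine Finset.sum_congr rfl fun i _ => ?_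
  simp [hp]

lemma isUnit_one_add {m : ℕ} (A : EuclideanSpace ℝ (Fin m) →L[ℝ] EuclideanSpace ℝ (Fin m))
    (h : ‖A‖ < 1) : IsUnit (1 + A) := by
  have := isUnit_one_sub_of_norm_lt_one (x := -A) (by simpa using h)
  simpa using this

lemma det_ne_zero_of_small {m : ℕ}
    (A : EuclideanSpace ℝ (Fin m) →L[ℝ] EuclideanSpace ℝ (Fin m))
    (h : ‖A‖ < 1) : (1 + A).det ≠ 0 := by
  have h1 := isUnit_one_add A h
  have h2 : IsUnit ((1 + A : EuclideanSpace ℝ (Fin m) →L[ℝ] EuclideanSpace ℝ (Fin m)).toLinearMap) :=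
    h1.map (ContinuousLinearMap.toLinearMapRingHom (R₁ := ℝ) (M₁ := EuclideanSpace ℝ (Fin m)))
  exact (LinearMap.isUnit_det _ h2).ne_zero

lemma det_pos_of_small {m : ℕ} (A : EuclideanSpace ℝ (Fin m) →L[ℝ] EuclideanSpace ℝ (Fin m))
    (h : ‖A‖ < 1) : 0 < (1 + A).det := by
  by_contra hneg
  push Not at hneg
  have hc : ContinuousOn (fun s : ℝ => (1 + s • A).det) (Set.Icc 0 1) := by
    apply Continuous.continuousOn
    exact ContinuousLinearMap.continuous_det.comp (by fun_prop)
  have := intermediate_value_Icc' (zero_le_one) hc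
  obtain ⟨s, hs, hs0⟩ := this (show (0:ℝ) ∈ _ by
    simp only [one_smul, zero_smul, add_zero]
    refine ⟨hneg, ?_⟩
    simp [ContinuousLinearMap.det])
  refine det_ne_zero_of_small (s • A) ?_ hs0
  rw [norm_smul, Real.norm_eq_abs, abs_of_nonneg hs.1]
  nlinarith [hs.2, norm_nonneg A]

lemma surj_of_det_ne_zero {m : ℕ}
    (A : EuclideanSpace ℝ (Fin m) →L[ℝ] EuclideanSpace ℝ (Fin m))
    (h : A.det ≠ 0) : A.range = ⊤ := by
  have h2 : IsUnit A.toLinearMap := (LinearMap.isUnit_iff_isUnit_det _).2 (isUnit_iff_ne_zero.2 h)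
  exact (LinearMap.isUnit_iff_range_eq_top _).1 h2

open MeasureTheory in
lemma no_retraction {m : ℕ} (r : EuclideanSpace ℝ (Fin m) → EuclideanSpace ℝ (Fin m))
    (hr : ContDiff ℝ 1 r) (h1 : ∀ x, ‖r x‖ = 1) (h2 : ∀ x, ‖x‖ = 1 → r x = x) : False := by
  let E := EuclideanSpace ℝ (Fin m)
  let v : E → E := fun x => r x - x
  have hv : ContDiff ℝ 1 v := hr.sub contDiff_id
  have hv' : Continuous (fderiv ℝ v) := hv.continuous_fderiv (by norm_num)
  have hdet : ∀ t : ℝ, Continuous (fun x => (1 + t • fderiv ℝ v x).det) := fun t =>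
    ContinuousLinearMap.continuous_det.comp (by fun_prop)
  have hIntg : ∀ t : ℝ, IntegrableOn (fun x => (1 + t • fderiv ℝ v x).det) (Metric.ball (0:E) 1) :=
    fun t => ((hdet t).continuousOn.integrableOn_compact
      (isCompact_closedBall (0:E) 1)).mono_set Metric.ball_subset_closedBall
  obtain ⟨C, hC0, hC⟩ : ∃ C : ℝ, 0 < C ∧ ∀ x ∈ Metric.closedBall (0:E) 1, ‖fderiv ℝ v x‖ ≤ C := by
    obtain ⟨C, hC⟩ := (isCompact_closedBall (0:E) 1).exists_bound_of_continuousOn hv'.continuousOn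
    exact ⟨max C 1, by positivity, fun x hx => (hC x hx).trans (le_max_left _ _)⟩
  -- small times
  have hsmall : ∀ t : ℝ, 0 < t → t < 1 → t * C < 1 →
      ∫ x in Metric.ball (0:E) 1, (1 + t • fderiv ℝ v x).det = volume.real (Metric.ball (0:E) 1) := by
    intro t ht0 ht1 htC
    let g : E → E := fun x => x + t • v x
    have hnorm : ∀ x ∈ Metric.closedBall (0:E) 1, ‖t • fderiv ℝ v x‖ < 1 := by
      intro x hx
      rw [norm_smul, Real.norm_eq_abs, abs_of_pos ht0]
      nlinarith [hC x hx]
    have hgs : ∀ x, HasStrictFDerivAt g (1 + t • fderiv ℝ v x) x := by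
      intro x
      have := (hv.contDiffAt (x := x)).hasStrictFDerivAt (by norm_num)
      exact (hasStrictFDerivAt_id x).add (this.const_smul t)
    have hgc : Continuous g := continuous_id.add (hv.continuous.const_smul t)
    have hinj : Set.InjOn g (Metric.ball (0:E) 1) := by
      intro x hx y hy hxy
      have hl : ‖v x - v y‖ ≤ C * ‖x - y‖ :=
        (convex_closedBall (0:E) 1).norm_image_sub_le_of_norm_fderiv_le
          (fun z _ => (hv.differentiable (by norm_num)) z) hC
          (Metric.ball_subset_closedBall hy) (Metric.ball_subset_closedBall hx)
      have he : x - y = - (t • (v x - v y)) := by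
        have : x + t • v x = y + t • v y := hxy
        calc x - y = (x + t • v x) - (y + t • v y) - t • (v x - v y) := by module
          _ = _ := by rw [this]; module
      have hn : ‖x - y‖ = t * ‖v x - v y‖ := by
        conv_lhs => rw [he, norm_neg, norm_smul, Real.norm_eq_abs, abs_of_pos ht0]
      have : ‖x - y‖ = 0 := by
        by_contra hne
        have hpos : 0 < ‖x - y‖ := lt_of_le_of_ne (norm_nonneg _) (Ne.symm hne)
        nlinarith
      exact sub_eq_zero.1 (norm_eq_zero.1 this)
    have hsub : g '' Metric.ball (0:E) 1 ⊆ Metric.ball (0:E) 1 := by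
      rintro _ ⟨x, hx, rfl⟩
      rw [mem_ball_zero_iff] at hx ⊢
      have : g x = (1 - t) • x + t • r x := by
        simp only [g, v]; module
      rw [this]
      calc _ ≤ ‖(1 - t) • x‖ + ‖t • r x‖ := norm_add_le _ _
        _ = (1 - t) * ‖x‖ + t := by
          rw [norm_smul, norm_smul, h1, Real.norm_eq_abs, Real.norm_eq_abs, abs_of_pos ht0,
            abs_of_pos (by linarith), mul_one]
        _ < 1 := by nlinarith
    have hopen : IsOpen (g '' Metric.ball (0:E) 1) := by
      rw [isOpen_iff_mem_nhds]
      rintro _ ⟨x, hx, rfl⟩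
      have hd := det_ne_zero_of_small _ (hnorm x (Metric.ball_subset_closedBall hx))
      rw [← (hgs x).map_nhds_eq_of_surj (surj_of_det_ne_zero _ hd)]
      exact Filter.image_mem_map (Metric.isOpen_ball.mem_nhds hx)
    have himg : g '' Metric.ball (0:E) 1 = Metric.ball (0:E) 1 := by
      refine hsub.antisymm ?_
      refine (convex_ball (0:E) 1).isPreconnected.subset_of_closure_inter_subset hopen ?_ ?_
      · have h0 : g 0 ∈ g '' Metric.ball (0:E) 1 := ⟨0, by simp, rfl⟩
        exact ⟨g 0, hsub h0, h0⟩
      · rintro y ⟨hy, hyb⟩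
        have hcl : IsClosed (g '' Metric.closedBall (0:E) 1) :=
          ((isCompact_closedBall (0:E) 1).image hgc).isClosed
        obtain ⟨x, hx, rfl⟩ := closure_minimal (Set.image_mono Metric.ball_subset_closedBall) hcl hy
        refine ⟨x, ?_, rfl⟩
        rw [mem_closedBall_zero_iff] at hx
        rw [mem_ball_zero_iff]
        refine lt_of_le_of_ne hx fun hx1 => ?_
        have : g x = x := by simp [g, v, h2 x hx1]
        rw [this, mem_ball_zero_iff] at hyb
        linarith
    have hch := integral_image_eq_integral_abs_det_fderiv_smul volume
      (Metric.isOpen_ball (x := (0:E)) (ε := 1)).measurableSet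
      (fun x _ => (hgs x).hasFDerivAt.hasFDerivWithinAt) hinj (fun _ => (1:ℝ))
    rw [himg] at hch
    simp only [smul_eq_mul, mul_one, integral_const, MeasurableSet.univ,
      measureReal_restrict_apply, Set.univ_inter] at hch
    rw [hch]
    refine setIntegral_congr_fun Metric.isOpen_ball.measurableSet fun x hx => ?_
    exact (abs_of_pos (det_pos_of_small _ (hnorm x (Metric.ball_subset_closedBall hx)))).symm
  -- interpolation
  let w : ℕ → ℝ := fun i => (1 / (C + 1)) * (1 / ((i:ℝ) + 2))
  have hw : Function.Injective w := by
    intro i j hij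
    have hC1 : (1 / (C+1)) ≠ 0 := by positivity
    have := mul_left_cancel₀ hC1 hij
    have hi : (i:ℝ) + 2 ≠ 0 := by positivity
    have hj : (j:ℝ) + 2 ≠ 0 := by positivity
    field_simp at this
    have h3 : (i:ℝ) = j := by linarith
    exact_mod_cast h3
  have hwv : ∀ i, ∫ x in Metric.ball (0:E) 1, (1 + w i • fderiv ℝ v x).det
      = volume.real (Metric.ball (0:E) 1) := by
    intro i
    have hi : 1 / ((i:ℝ) + 2) < 1 := by
      rw [div_lt_one (by positivity)]; linarith [Nat.cast_nonneg (α := ℝ) i]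
    have hi0 : 0 < 1 / ((i:ℝ) + 2) := by positivity
    have hc : 1 / (C+1) < 1 := by rw [div_lt_one (by positivity)]; linarith
    have hc0 : 0 < 1 / (C+1) := by positivity
    have hcc : 1 / (C+1) * C < 1 := by
      rw [one_div, inv_mul_lt_one₀ (by positivity)]; linarith
    have hcc0 : 0 < 1 / (C+1) * C := by positivity
    refine hsmall _ (by positivity) ?_ ?_
    · simp only [w]; nlinarith
    · simp only [w]; nlinarith
  have hone : ∫ x in Metric.ball (0:E) 1, (1 + (1:ℝ) • fderiv ℝ v x).det
      = volume.real (Metric.ball (0:E) 1) := by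
    simp_rw [fun x => det_interp (fderiv ℝ v x) w hw 1]
    rw [integral_finsetSum _ (fun i _ => (hIntg (w i)).mul_const _)]
    simp_rw [integral_mul_const, hwv, ← Finset.mul_sum]
    rw [← Polynomial.eval_finsetSum, Lagrange.sum_basis hw.injOn (by simp)]
    simp
  have hzero : ∀ x, (1 + (1:ℝ) • fderiv ℝ v x).det = 0 := by
    intro x
    by_contra hne
    have hs := surj_of_det_ne_zero _ hne
    have hrd : HasFDerivAt r (fderiv ℝ r x) x := (hr.differentiable (by norm_num) x).hasFDerivAt
    have he : 1 + (1:ℝ) • fderiv ℝ v x = fderiv ℝ r x := by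
      have : HasFDerivAt v (fderiv ℝ r x - ContinuousLinearMap.id ℝ E) x := hrd.sub (hasFDerivAt_id x)
      rw [this.fderiv, one_smul]
      ext1 z; simp
    rw [he] at hs
    obtain ⟨z, hz⟩ : r x ∈ (fderiv ℝ r x).range := by rw [hs]; trivial
    have hz : fderiv ℝ r x z = r x := hz
    have hd := hrd.norm_sq
    have hconst : (fun x => ‖r x‖ ^ 2) = fun _ => (1:ℝ) := by ext; simp [h1]
    rw [hconst] at hd
    have := (hd.unique (hasFDerivAt_const (1:ℝ) x))
    have := congrArg (fun L => L z) this
    simp [hz, h1] at this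
  simp_rw [hzero] at hone
  have : 0 < volume.real (Metric.ball (0:E) 1) := by
    rw [measureReal_def]
    exact ENNReal.toReal_pos (Metric.measure_ball_pos _ _ one_pos).ne' measure_ball_lt_top.ne
  simp at hone
  rw [← hone] at this
  exact lt_irrefl _ this

lemma no_injection {m d : ℕ} (hmd : d < m)
    (f : EuclideanSpace ℝ (Fin m) → EuclideanSpace ℝ (Fin d))
    (hf : Continuous f) (hinj : Function.Injective f) : False := by
  let E := EuclideanSpace ℝ (Fin m)
  let F := EuclideanSpace ℝ (Fin d)
  let K : Set E := Metric.closedBall 0 1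
  have hK : IsCompact K := isCompact_closedBall 0 1
  haveI : CompactSpace K := isCompact_iff_compactSpace.1 hK
  let e : K → F := fun x => f x
  have he : Topology.IsClosedEmbedding e :=
    (hf.comp continuous_subtype_val).isClosedEmbedding
      (fun x y hxy => Subtype.ext (hinj hxy))
  haveI : TietzeExtension.{0, 0} E := TietzeExtension.of_homeo
    (PiLp.homeomorph 2 (fun _ : Fin m => ℝ))
  obtain ⟨g, hg⟩ := ContinuousMap.exists_extension' he
    (⟨fun x => (x : E), continuous_subtype_val⟩ : C(K, E))
  have hg1 : ∀ x ∈ K, g (f x) = x := fun x hx => congrFun hg ⟨x, hx⟩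
  obtain ⟨g', hg's, hg'd, -⟩ := g.continuous.exists_contDiff_approx (ε := fun _ => 1/8) 1
    continuous_const (fun _ => by norm_num)
  obtain ⟨δ, hδ, hδ'⟩ : ∃ δ > 0, ∀ a ∈ f '' K, ∀ b, dist a b < δ → dist (g' a) (g' b) < 1/8 := by
    have := (hK.image hf).uniformContinuousAt_of_continuousAt g'
      (fun a _ => hg's.continuous.continuousAt) (Metric.dist_mem_uniformity (show (0:ℝ) < 1/8 by norm_num))
    obtain ⟨δ, hδ, h⟩ := Metric.mem_uniformity_dist.1 this
    exact ⟨δ, hδ, fun a ha b hab => h hab ha⟩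
  obtain ⟨f', hf's, hf'd, -⟩ := hf.exists_contDiff_approx (ε := fun _ => δ) 1
    continuous_const (fun _ => hδ)
  have hdense := hg's.dense_compl_range_of_finrank_lt_finrank (by
    rw [show Module.finrank ℝ F = d from finrank_euclideanSpace_fin,
      show Module.finrank ℝ E = m from finrank_euclideanSpace_fin]
    exact hmd)
  obtain ⟨y, hy, hyr⟩ := hdense.exists_dist_lt (0:E) (show (0:ℝ) < 1/4 by norm_num)
  have hyn : ‖y‖ < 1/4 := by rwa [dist_zero_left] at hyr
  let H : E → E := fun x => g' (f' x) - y
  have hHs : ContDiff ℝ 1 H := (hg's.comp hf's).sub contDiff_const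
  have hH0 : ∀ x, H x ≠ 0 := fun x h => hy ⟨f' x, sub_eq_zero.1 h⟩
  have hHx : ∀ x ∈ K, ‖H x - x‖ < 1/2 := by
    intro x hx
    have a1 : dist (g' (f x)) x < 1/8 := by
      have := hg'd (f x); rwa [hg1 x hx] at this
    have a2 : dist (g' (f' x)) (g' (f x)) < 1/8 := by
      rw [dist_comm]
      exact hδ' _ ⟨x, hx, rfl⟩ _ (by rw [dist_comm]; exact hf'd x)
    have a3 := dist_triangle (g' (f' x)) (g' (f x)) x
    rw [dist_eq_norm (g' (f' x)) x] at a3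
    have : H x - x = (g' (f' x) - x) - y := by simp only [H]; abel
    rw [this]
    have := norm_sub_le (g' (f' x) - x) y
    linarith
  let χ : ContDiffBump (0:E) := ⟨1/2, 3/4, by norm_num, by norm_num⟩
  let G : E → E := fun x => x + χ x • (H x - x)
  have hGs : ContDiff ℝ 1 G := contDiff_id.add (χ.contDiff.smul (hHs.sub contDiff_id))
  have hGout : ∀ x : E, 3/4 ≤ ‖x‖ → G x = x := by
    intro x hx
    have : χ x = 0 := χ.zero_of_le_dist (by simpa [χ] using hx)
    simp [G, this]
  have hG0 : ∀ x, G x ≠ 0 := by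
    intro x hx
    by_cases hs : ‖x‖ ≤ 1/2
    · have : χ x = 1 := χ.one_of_mem_closedBall (by simpa [χ] using hs)
      apply hH0 x
      simpa [G, this] using hx
    · push Not at hs
      by_cases hb : 3/4 ≤ ‖x‖
      · rw [hGout x hb] at hx
        rw [hx, norm_zero] at hs
        linarith
      · push Not at hb
        have hn := hHx x (by simp only [K, mem_closedBall_zero_iff]; linarith)
        have hxe : x = - (χ x • (H x - x)) := eq_neg_of_add_eq_zero_left hx
        have : ‖x‖ ≤ ‖H x - x‖ := by
          conv_lhs => rw [hxe, norm_neg, norm_smul, Real.norm_eq_abs, abs_of_nonneg χ.nonneg]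
          exact mul_le_of_le_one_left (norm_nonneg _) χ.le_one
        linarith
  refine no_retraction (fun x => ‖G x‖⁻¹ • G x) ?_ ?_ ?_
  · exact ((hGs.norm ℝ hG0).inv (fun x => norm_ne_zero_iff.2 (hG0 x))).smul hGs
  · intro x
    rw [norm_smul, norm_inv, norm_norm, inv_mul_cancel₀ (norm_ne_zero_iff.2 (hG0 x))]
  · intro x hx
    simp only [hGout x (by rw [hx]; norm_num), hx, inv_one, one_smul]

theorem stmt_0 (m d : ℕ) (hmd : m > d)
    (f : Metric.sphere (0 : EuclideanSpace ℝ (Fin (m+1))) 1 → EuclideanSpace ℝ (Fin d))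
    (hf : Continuous f) :
    ∃ p₁ p₂ : Metric.sphere (0 : EuclideanSpace ℝ (Fin (m+1))) 1,
      p₁ ≠ p₂ ∧ p₁ ≠ -p₂ ∧ f p₁ = f p₂ := by
  by_contra hcon
  push Not at hcon
  let q : EuclideanSpace ℝ (Fin m) → EuclideanSpace ℝ (Fin (m+1)) :=
    fun x => WithLp.toLp 2 (Fin.cons 1 (fun i => x i))
  have hqc : Continuous q := by
    refine (PiLp.continuous_toLp 2 _).comp (continuous_pi fun i => ?_)
    refine Fin.cases ?_ (fun j => ?_) i
    · simpa using continuous_const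
    · simp only [Fin.cons_succ]; fun_prop
  have hq0 : ∀ x, q x 0 = 1 := fun x => by simp [q]
  have hqs : ∀ x i, q x (Fin.succ i) = x i := fun x i => by simp [q]
  have hqn : ∀ x, 0 < ‖q x‖ := by
    intro x
    rw [norm_pos_iff]
    intro h
    have := hq0 x
    rw [h] at this
    simp at this
  let φ : EuclideanSpace ℝ (Fin m) → Metric.sphere (0 : EuclideanSpace ℝ (Fin (m+1))) 1 :=
    fun x => ⟨‖q x‖⁻¹ • q x, by
      rw [mem_sphere_zero_iff_norm, norm_smul, norm_inv, norm_norm, inv_mul_cancel₀ (hqn x).ne']⟩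
  have hφc : Continuous φ :=
    Continuous.subtype_mk ((hqc.norm.inv₀ fun x => (hqn x).ne').smul hqc) _
  have hφ0 : ∀ x, (φ x : EuclideanSpace ℝ (Fin (m+1))) 0 = ‖q x‖⁻¹ := fun x => by
    simp [φ, hq0]
  have hφs : ∀ x i, (φ x : EuclideanSpace ℝ (Fin (m+1))) (Fin.succ i) = ‖q x‖⁻¹ * x i :=
    fun x i => by simp [φ, hqs]
  refine no_injection hmd (fun x => f (φ x)) (hf.comp hφc) ?_
  intro x y hxy
  by_contra hne
  refine hcon (φ x) (φ y) ?_ ?_ hxy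
  · intro h
    apply hne
    have h0 : ‖q x‖⁻¹ = ‖q y‖⁻¹ := by rw [← hφ0, ← hφ0, h]
    ext i
    have h1 := hφs x i
    rw [h, hφs y i, h0] at h1
    exact (mul_left_cancel₀ (inv_pos.2 (hqn y)).ne' h1).symm
  · intro h
    have h0 := hφ0 x
    rw [h] at h0
    change -((φ y : EuclideanSpace ℝ (Fin (m+1))) 0) = _ at h0
    rw [hφ0] at h0
    have := inv_pos.2 (hqn x)
    have := inv_pos.2 (hqn y)
    linarith
end

section
/- Let f : S^m → ℝ^d be a continuous odd map (f(-p) = -f(p) for all p). If m is odd and m ≥ max{2, d}, then there exist points p₁, p₂ ∈ S^m with p₁ ≠ p₂ and p₁ ≠ -p₂ such that f(p₁) = f(p₂). -/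
open Polynomial in
theorem real_odd_root (p : ℝ[X]) (hp : Odd p.natDegree) : ∃ x, p.IsRoot x := by
  have key : ∀ q : ℝ[X], Odd q.natDegree → 0 ≤ q.leadingCoeff → ∃ x, q.IsRoot x := by
    intro q hq hl
    have h1 := q.tendsto_atTop_of_leadingCoeff_nonneg (natDegree_pos_iff_degree_pos.1 hq.pos) hl
    have hd : (q.comp (-X)).natDegree = q.natDegree := by simp [natDegree_comp]
    have hlc : (q.comp (-X)).leadingCoeff = - q.leadingCoeff := by
      rw [leadingCoeff_comp (by simp)]
      simp [hq.neg_one_pow]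
    have h2 := (q.comp (-X)).tendsto_atBot_of_leadingCoeff_nonpos
      (natDegree_pos_iff_degree_pos.1 (by rw [hd]; exact hq.pos)) (by rw [hlc]; linarith)
    obtain ⟨a, ha⟩ := (h1.eventually_ge_atTop 0).exists
    obtain ⟨b, hb⟩ := (h2.eventually_le_atBot 0).exists
    have hb' : q.eval (-b) ≤ 0 := by simpa using hb
    obtain ⟨x, hx⟩ := mem_range_of_exists_le_of_exists_ge q.continuous ⟨_, hb'⟩ ⟨_, ha⟩
    exact ⟨x, hx⟩
  rcases le_total 0 p.leadingCoeff with h | h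
  · exact key p hp h
  · obtain ⟨x, hx⟩ := key (-p) (by simpa using hp) (by simpa using h)
    exact ⟨x, by simpa [IsRoot] using hx⟩

theorem common_eig {P : Type*} [CommRing P] [Algebra ℝ P] (k : ℕ) : ∀ (M : Type) [AddCommGroup M]
    [Module P M] [Module ℝ M] [IsScalarTower ℝ P M] [FiniteDimensional ℝ M],
    Module.finrank ℝ M = k → Odd k → ∃ v : M, v ≠ 0 ∧ ∀ p : P, ∃ c : ℝ, p • v = c • v := by
  induction k using Nat.strong_induction_on with
  | _ k ih =>
  intro M _ _ _ _ _ hk hodd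
  by_cases hsc : ∀ p : P, ∃ c : ℝ, ∀ v : M, p • v = c • v
  · have : Nontrivial M := Module.nontrivial_of_finrank_pos (R := ℝ) (by rw [hk]; exact hodd.pos)
    obtain ⟨v, hv⟩ := exists_ne (0 : M)
    exact ⟨v, hv, fun p => (hsc p).imp fun c hc => hc v⟩
  · push Not at hsc
    obtain ⟨a, ha⟩ := hsc
    let T : Module.End ℝ M := Algebra.lsmul ℝ ℝ M a
    obtain ⟨c, hc⟩ := real_odd_root T.charpoly (by rw [LinearMap.charpoly_natDegree, hk]; exact hodd)
    rw [← Module.End.hasEigenvalue_iff_isRoot_charpoly] at hc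
    obtain ⟨v, hv⟩ := hc.exists_hasEigenvector
    have hv1 : a • v = c • v := hv.apply_eq_smul
    have hv0 : v ≠ 0 := hv.2
    let S : M →ₗ[P] M := LinearMap.lsmul P M (a - algebraMap ℝ P c)
    have hS : ∀ w, S w = a • w - c • w := fun w => by simp [S]
    have hsum := (S.restrictScalars ℝ).finrank_range_add_finrank_ker
    have hker : Module.finrank ℝ (LinearMap.ker (S.restrictScalars ℝ)) < k := by
      rw [← hk]
      apply Submodule.finrank_lt
      intro h
      obtain ⟨w, hw⟩ := ha c
      have : w ∈ LinearMap.ker (S.restrictScalars ℝ) := by rw [h]; trivial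
      have : S w = 0 := this
      rw [hS, sub_eq_zero] at this
      exact hw this
    have hker0 : 0 < Module.finrank ℝ (LinearMap.ker (S.restrictScalars ℝ)) := by
      have : Nontrivial (LinearMap.ker (S.restrictScalars ℝ)) :=
        ⟨⟨v, by change S v = 0; rw [hS, hv1, sub_self]⟩, 0, fun h => hv0 (congrArg Subtype.val h)⟩
      exact Module.finrank_pos
    rw [hk] at hsum
    rcases Nat.even_or_odd (Module.finrank ℝ (LinearMap.ker (S.restrictScalars ℝ))) with he | ho
    · have ho : Odd (Module.finrank ℝ (LinearMap.range (S.restrictScalars ℝ))) := by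
        rw [← hsum] at hodd
        exact (Nat.odd_add.1 hodd).2 he
      have : FiniteDimensional ℝ (LinearMap.range S) :=
        inferInstanceAs (FiniteDimensional ℝ (LinearMap.range (S.restrictScalars ℝ)))
      obtain ⟨w, hw, h⟩ := @ih (Module.finrank ℝ (LinearMap.range (S.restrictScalars ℝ))) (by omega) (LinearMap.range S)
        _ _ _ ⟨fun r p x => Subtype.ext (smul_assoc r p x.1)⟩ this rfl ho
      refine ⟨w, by simpa using hw, fun p => (h p).imp fun c hc => by simpa using congrArg Subtype.val hc⟩
    · have : FiniteDimensional ℝ (LinearMap.ker S) :=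
        inferInstanceAs (FiniteDimensional ℝ (LinearMap.ker (S.restrictScalars ℝ)))
      obtain ⟨w, hw, h⟩ := @ih _ hker (LinearMap.ker S)
        _ _ _ ⟨fun r p x => Subtype.ext (smul_assoc r p x.1)⟩ this rfl ho
      refine ⟨w, by simpa using hw, fun p => (h p).imp fun c hc => by simpa using congrArg Subtype.val hc⟩

open MvPolynomial in
open scoped Pointwise in
theorem W_mul {n : ℕ} {a b c : ℕ} {f g : MvPolynomial (Fin n) ℝ}
    (hf : f ∈ restrictSupport ℝ {s : Fin n →₀ ℕ | s.degree < a})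
    (hg : g ∈ restrictSupport ℝ {s : Fin n →₀ ℕ | s.degree < b}) (h : a + b ≤ c + 1) :
    f * g ∈ restrictSupport ℝ {s : Fin n →₀ ℕ | s.degree < c} := by
  have : f * g ∈ restrictSupport ℝ
      ({s : Fin n →₀ ℕ | s.degree < a} + {s : Fin n →₀ ℕ | s.degree < b}) := by
    rw [restrictSupport_add]
    exact Submodule.mul_mem_mul hf hg
  refine restrictSupport_mono ℝ ?_ this
  rintro _ ⟨s, hs, t, ht, rfl⟩
  simp only [Set.mem_ofPred_eq, map_add] at *
  omega

open MvPolynomial in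
/-- `f` is the monomial `s` plus terms of lower degree. -/
def GoodLead {n : ℕ} (s : Fin n →₀ ℕ) (f : MvPolynomial (Fin n) ℝ) : Prop :=
  f - monomial s 1 ∈ restrictSupport ℝ {t : Fin n →₀ ℕ | t.degree < s.degree}

open MvPolynomial in
theorem GoodLead.mul {n : ℕ} {s t : Fin n →₀ ℕ} {f g : MvPolynomial (Fin n) ℝ}
    (hf : GoodLead s f) (hg : GoodLead t g) : GoodLead (s + t) (f * g) := by
  have hg' : g ∈ restrictSupport ℝ {u : Fin n →₀ ℕ | u.degree < t.degree + 1} := by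
    have h1 := restrictSupport_mono (R := ℝ) (s := {u : Fin n →₀ ℕ | u.degree < t.degree})
      (t := {u : Fin n →₀ ℕ | u.degree < t.degree + 1})
      (fun u hu => Nat.lt_succ_of_lt hu) hg
    have h2 : monomial t (1:ℝ) ∈ restrictSupport ℝ {u : Fin n →₀ ℕ | u.degree < t.degree + 1} := by
      simp
    have := add_mem h1 h2
    simpa using this
  have h3 : monomial s (1:ℝ) ∈ restrictSupport ℝ {u : Fin n →₀ ℕ | u.degree < s.degree + 1} := by
    simp
  have e : f * g - monomial (s + t) 1 =
      (f - monomial s 1) * g + monomial s 1 * (g - monomial t 1) := by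
    rw [show monomial (s + t) (1:ℝ) = monomial s 1 * monomial t 1 by simp [monomial_mul]]
    ring
  unfold GoodLead
  rw [e]
  refine add_mem (W_mul hf hg' ?_) (W_mul h3 hg ?_) <;> rw [map_add] <;> omega

open MvPolynomial in
theorem goodLead_monomial {n : ℕ} (s : Fin n →₀ ℕ) : GoodLead s (monomial s (1:ℝ)) := by
  simp [GoodLead]

open MvPolynomial in
theorem GoodLead.pow {n : ℕ} {s : Fin n →₀ ℕ} {f : MvPolynomial (Fin n) ℝ}
    (hf : GoodLead s f) (k : ℕ) : GoodLead (k • s) (f ^ k) := by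
  induction k with
  | zero => simpa using goodLead_monomial (0 : Fin n →₀ ℕ)
  | succ k ih => rw [pow_succ, succ_nsmul]; exact ih.mul hf

open MvPolynomial in
theorem GoodLead.prod {n : ℕ} {ι : Type*} (u : Finset ι) {s : ι → Fin n →₀ ℕ}
    {f : ι → MvPolynomial (Fin n) ℝ}
    (hf : ∀ i, GoodLead (s i) (f i)) : GoodLead (∑ i ∈ u, s i) (∏ i ∈ u, f i) := by
  classical
  induction u using Finset.induction_on with
  | empty => simpa using goodLead_monomial (0 : Fin n →₀ ℕ)
  | insert a u ha ih => rw [Finset.sum_insert ha, Finset.prod_insert ha]; exact (hf a).mul ih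

open MvPolynomial in
theorem unitri_bij {n : ℕ} (T : MvPolynomial (Fin n) ℝ →ₗ[ℝ] MvPolynomial (Fin n) ℝ)
    (hT : ∀ s, GoodLead s (T (monomial s 1))) : Function.Bijective T := by
  have key : ∀ D, ∀ p ∈ restrictSupport ℝ {t : Fin n →₀ ℕ | t.degree < D + 1},
      T p - p ∈ restrictSupport ℝ {t : Fin n →₀ ℕ | t.degree < D} := by
    intro D
    have : restrictSupport ℝ {t : Fin n →₀ ℕ | t.degree < D + 1} ≤
        (restrictSupport ℝ {t : Fin n →₀ ℕ | t.degree < D}).comap (T - LinearMap.id) := by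
      rw [restrictSupport_eq_span, Submodule.span_le]
      rintro _ ⟨s, hs, rfl⟩
      exact restrictSupport_mono ℝ (fun t ht => lt_of_lt_of_le ht (Nat.lt_succ_iff.1 hs)) (hT s)
    exact fun p hp => this hp
  have exD : ∀ p : MvPolynomial (Fin n) ℝ, ∃ D,
      p ∈ restrictSupport ℝ {t : Fin n →₀ ℕ | t.degree < D} := by
    intro p
    refine ⟨p.support.sup (fun t => t.degree) + 1, fun t ht => Nat.lt_succ_of_le ?_⟩
    exact Finset.le_sup (f := fun t : Fin n →₀ ℕ => t.degree) ht
  have W0 : ∀ p ∈ restrictSupport ℝ {t : Fin n →₀ ℕ | t.degree < 0}, p = 0 := by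
    intro p hp
    rw [mem_restrictSupport_iff] at hp
    rw [← support_eq_empty]
    exact Finset.eq_empty_of_forall_notMem fun t ht => absurd (hp ht) (by simp)
  constructor
  · rw [injective_iff_map_eq_zero]
    intro p hp
    have : ∀ D, p ∈ restrictSupport ℝ {t : Fin n →₀ ℕ | t.degree < D} → p = 0 := by
      intro D
      induction D with
      | zero => exact W0 p
      | succ D ih =>
        intro h
        have := key D p h
        rw [hp, zero_sub, neg_mem_iff] at this
        exact ih this
    obtain ⟨D, hD⟩ := exD p
    exact this D hD
  · have : ∀ D, ∀ p ∈ restrictSupport ℝ {t : Fin n →₀ ℕ | t.degree < D}, ∃ q, T q = p := by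
      intro D
      induction D with
      | zero => exact fun p hp => ⟨0, by rw [W0 p hp, map_zero]⟩
      | succ D ih =>
        intro p h
        obtain ⟨q, hq⟩ := ih _ (key D p h)
        exact ⟨p - q, by rw [map_sub, hq]; abel⟩
    intro p
    obtain ⟨D, hD⟩ := exD p
    exact this D p hD

open MvPolynomial in
theorem isCompl_restrictSupport {n : ℕ} (S : Set (Fin n →₀ ℕ)) :
    IsCompl (restrictSupport ℝ S) (restrictSupport ℝ Sᶜ) := by
  constructor
  · rw [Submodule.disjoint_def]
    intro p h1 h2
    rw [mem_restrictSupport_iff] at h1 h2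
    rw [← support_eq_empty]
    exact Finset.eq_empty_of_forall_notMem fun t ht => (h2 ht) (h1 ht)
  · rw [codisjoint_iff, eq_top_iff]
    intro p _
    rw [p.as_sum]
    refine Submodule.sum_mem _ fun s _ => ?_
    by_cases h : s ∈ S
    · exact Submodule.mem_sup_left (by simp [h])
    · exact Submodule.mem_sup_right (by simp [h])

open MvPolynomial in
theorem real_zero {n : ℕ} (K : ℕ) (hK : Odd K) (F : Fin n → MvPolynomial (Fin n) ℝ)
    (hF : ∀ i, (F i).totalDegree < K) : ∃ x : Fin n → ℝ, ∀ i, x i ^ K + eval x (F i) = 0 := by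
  classical
  let E : Fin n → MvPolynomial (Fin n) ℝ := fun i => X i ^ K + F i
  have hE : ∀ i, GoodLead (Finsupp.single i K) (E i) := by
    intro i
    have : E i - monomial (Finsupp.single i K) 1 = F i := by
      simp [E, X_pow_eq_monomial]
    unfold GoodLead
    rw [this]
    intro t ht
    have := le_totalDegree (p := F i) ht
    simp only [Set.mem_ofPred_eq, Finsupp.degree_single]
    exact lt_of_le_of_lt this (hF i)
  let G : (Fin n →₀ ℕ) → MvPolynomial (Fin n) ℝ := fun s =>
    monomial (s.mapRange (· % K) (Nat.zero_mod K)) 1 * ∏ i, E i ^ (s i / K)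
  let T : MvPolynomial (Fin n) ℝ →ₗ[ℝ] MvPolynomial (Fin n) ℝ := (basisMonomials (Fin n) ℝ).constr ℝ G
  have hTs : ∀ s, T (monomial s 1) = G s := by
    intro s
    have := (basisMonomials (Fin n) ℝ).constr_basis ℝ G s
    simpa [coe_basisMonomials] using this
  have hT : ∀ s, GoodLead s (T (monomial s 1)) := by
    intro s
    rw [hTs]
    have := (goodLead_monomial (s.mapRange (· % K) (Nat.zero_mod K))).mul
      (GoodLead.prod Finset.univ fun i => (hE i).pow (s i / K))
    convert this using 1
    ext j
    simp only [Finsupp.add_apply, Finsupp.mapRange_apply, Finsupp.finsetSum_apply,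
      Finsupp.smul_apply, Finsupp.single_apply, smul_eq_mul, mul_ite, mul_zero,
      Finset.sum_ite_eq', Finset.mem_univ, if_true]
    rw [mul_comm, Nat.mod_add_div]
  let Te := LinearEquiv.ofBijective T (unitri_bij T hT)
  let S : Set (Fin n →₀ ℕ) := {s | ∀ i, s i < K}
  let I : Ideal (MvPolynomial (Fin n) ℝ) := Ideal.span (Set.range E)
  have hI : (restrictSupport ℝ Sᶜ).map (Te : MvPolynomial (Fin n) ℝ →ₗ[ℝ] MvPolynomial (Fin n) ℝ)
      = I.restrictScalars ℝ := by
    apply le_antisymm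
    · rw [Submodule.map_le_iff_le_comap, restrictSupport_eq_span, Submodule.span_le]
      rintro _ ⟨s, hs, rfl⟩
      change T (monomial s 1) ∈ I
      rw [hTs]
      obtain ⟨i, hi⟩ : ∃ i, K ≤ s i := by simpa [S] using hs
      apply Ideal.mul_mem_left
      rw [← Finset.mul_prod_erase _ _ (Finset.mem_univ i)]
      apply Ideal.mul_mem_right
      apply Ideal.pow_mem_of_mem
      · exact Ideal.subset_span ⟨i, rfl⟩
      · exact Nat.div_pos hi hK.pos
    · intro p hp
      have hp : p ∈ I := hp
      obtain ⟨c, rfl⟩ := Ideal.mem_span_range_iff_exists_fun.1 hp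
      refine Submodule.sum_mem _ fun i _ => ?_
      obtain ⟨r, hr⟩ := (unitri_bij T hT).2 (c i)
      rw [← hr, mul_comm]
      have hle : restrictSupport ℝ (Set.univ : Set (Fin n →₀ ℕ)) ≤ ((restrictSupport ℝ Sᶜ).map
          (Te : MvPolynomial (Fin n) ℝ →ₗ[ℝ] MvPolynomial (Fin n) ℝ)).comap
          (LinearMap.mulLeft ℝ (E i) ∘ₗ T) := by
        rw [restrictSupport_eq_span, Submodule.span_le]
        rintro _ ⟨s, -, rfl⟩
        refine ⟨monomial (s + Finsupp.single i K) 1, ?_, ?_⟩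
        · simp [S]
          exact ⟨i, by simp⟩
        · change T _ = E i * T (monomial s 1)
          rw [hTs, hTs]
          have h1 : (s + Finsupp.single i K).mapRange (· % K) (Nat.zero_mod K) =
              s.mapRange (· % K) (Nat.zero_mod K) := by
            ext j
            simp only [Finsupp.mapRange_apply, Finsupp.add_apply, Finsupp.single_apply]
            split_ifs <;> simp
          have h2 : ∏ j, E j ^ ((s + Finsupp.single i K) j / K) = E i * ∏ j, E j ^ (s j / K) := by
            have : ∀ j, E j ^ ((s + Finsupp.single i K) j / K) =
                (if i = j then E j else 1) * E j ^ (s j / K) := by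
              intro j
              simp only [Finsupp.add_apply, Finsupp.single_apply]
              split_ifs
              · rw [Nat.add_div_right _ hK.pos, pow_succ, mul_comm]
              · simp
            simp only [this, Finset.prod_mul_distrib, Finset.prod_ite_eq, Finset.mem_univ, if_true]
          simp only [G]
          rw [h1, h2]
          ring
      exact hle (by rw [restrictSupport_univ]; trivial)
  let e1 : (MvPolynomial (Fin n) ℝ ⧸ restrictSupport ℝ Sᶜ) ≃ₗ[ℝ] (MvPolynomial (Fin n) ℝ ⧸ I.restrictScalars ℝ) :=
    Submodule.Quotient.equiv _ _ Te hI
  let e2 := Submodule.quotientEquivOfIsCompl _ _ (isCompl_restrictSupport S).symm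
  let eS : S ≃ (Fin n → Fin K) :=
    { toFun := fun s i => ⟨s.1 i, s.2 i⟩
      invFun := fun g => ⟨Finsupp.equivFunOnFinite.symm fun i => (g i : ℕ), fun i => by simp⟩
      left_inv := fun s => by ext; simp
      right_inv := fun g => by ext; simp }
  have : Fintype S := Fintype.ofEquiv _ eS.symm
  let b : Module.Basis S ℝ (MvPolynomial (Fin n) ℝ ⧸ I.restrictScalars ℝ) :=
    ((basisRestrictSupport ℝ S).map e2.symm).map e1
  have hcard : Module.finrank ℝ (MvPolynomial (Fin n) ℝ ⧸ I.restrictScalars ℝ) = K ^ n := by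
    rw [Module.finrank_eq_card_basis b, Fintype.card_congr eS]
    simp
  have hfd : FiniteDimensional ℝ (MvPolynomial (Fin n) ℝ ⧸ I.restrictScalars ℝ) := b.finiteDimensional_of_finite
  obtain ⟨v, hv0, hv⟩ := @common_eig (MvPolynomial (Fin n) ℝ) _ _ (K ^ n)
    (MvPolynomial (Fin n) ℝ ⧸ I) (Submodule.Quotient.addCommGroup I) (Submodule.Quotient.module I)
    (Submodule.Quotient.module' I) inferInstance hfd hcard hK.pow
  choose x hx using fun i => hv (X i)
  have hev : ∀ p : MvPolynomial (Fin n) ℝ, p • v = (eval x p) • v := by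
    intro p
    induction p using MvPolynomial.induction_on with
    | C a => rw [eval_C, ← MvPolynomial.algebraMap_eq, algebraMap_smul]
    | add p q hp hq => rw [add_smul, hp, hq, map_add, add_smul]
    | mul_X p i hp =>
      rw [mul_smul, hx, smul_comm, hp, map_mul, eval_X, smul_smul, mul_comm]
  refine ⟨x, fun i => ?_⟩
  have h0 : E i • v = 0 := by
    obtain ⟨w, rfl⟩ := Submodule.Quotient.mk_surjective _ v
    rw [← Submodule.Quotient.mk_smul, Submodule.Quotient.mk_eq_zero]
    exact Ideal.mul_mem_right _ _ (Ideal.subset_span ⟨i, rfl⟩)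
  rw [hev] at h0
  have := (smul_eq_zero.1 h0).resolve_right hv0
  simpa [E] using this

theorem poly_approx {n : ℕ} (K : Set (Fin n → ℝ)) (hK : IsCompact K)
    (g : (Fin n → ℝ) → (Fin n → ℝ)) (hg : Continuous g) (ε : ℝ) (hε : 0 < ε) :
    ∃ F : Fin n → MvPolynomial (Fin n) ℝ, ∀ x ∈ K, ∀ i, |MvPolynomial.eval x (F i) - g x i| < ε := by
  let Φ : MvPolynomial (Fin n) ℝ →ₐ[ℝ] C(Fin n → ℝ, ℝ) :=
    MvPolynomial.aeval fun i => ⟨fun x => x i, continuous_apply i⟩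
  have hΦ : ∀ p x, Φ p x = MvPolynomial.eval x p := by
    intro p x
    induction p using MvPolynomial.induction_on with
    | C a => simp [Φ]
    | add p q hp hq => simp [hp, hq]
    | mul_X p i hp => simp [hp]; simp [Φ]
  have hsep : (Φ.range).SeparatesPoints := by
    intro x y hxy
    obtain ⟨i, hi⟩ := Function.ne_iff.1 hxy
    refine ⟨Φ (MvPolynomial.X i), ⟨Φ (MvPolynomial.X i), ⟨_, rfl⟩, rfl⟩, ?_⟩
    simpa [Φ] using hi
  have : ∀ i, ∃ p : MvPolynomial (Fin n) ℝ, ∀ x ∈ K, |MvPolynomial.eval x p - g x i| < ε := by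
    intro i
    obtain ⟨a, ⟨p, hp⟩, ha⟩ :=
      ContinuousMap.exists_mem_subalgebra_near_continuous_of_isCompact_of_separatesPoints hsep
        ⟨fun x => g x i, (continuous_apply i).comp hg⟩ hK hε
    refine ⟨p, fun x hx => ?_⟩
    have := ha x hx
    rw [← hΦ]
    rw [← hp] at this
    simpa using this
  choose F hF using this
  exact ⟨F, fun x hx i => hF i x hx⟩

theorem poly_growth {n : ℕ} (p : MvPolynomial (Fin n) ℝ) (D : ℕ) (hD : p.totalDegree ≤ D) :
    ∃ C : ℝ, ∀ x : Fin n → ℝ, 1 ≤ ‖x‖ → |MvPolynomial.eval x p| ≤ C * ‖x‖ ^ D := by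
  refine ⟨∑ s ∈ p.support, |p.coeff s|, fun x hx => ?_⟩
  rw [MvPolynomial.eval_eq, Finset.sum_mul]
  refine (Finset.abs_sum_le_sum_abs _ _).trans (Finset.sum_le_sum fun s hs => ?_)
  rw [abs_mul]
  refine mul_le_mul_of_nonneg_left ?_ (abs_nonneg _)
  rw [Finset.abs_prod]
  calc ∏ i ∈ s.support, |x i ^ s i| ≤ ∏ i ∈ s.support, ‖x‖ ^ s i := by
        refine Finset.prod_le_prod (fun _ _ => abs_nonneg _) fun i _ => ?_
        rw [abs_pow]
        exact pow_le_pow_left₀ (abs_nonneg _) (norm_le_pi_norm x i) _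
    _ = ‖x‖ ^ (∑ i ∈ s.support, s i) := Finset.prod_pow_eq_pow_sum _ _ _
    _ ≤ ‖x‖ ^ D := pow_le_pow_right₀ hx ((MvPolynomial.le_totalDegree hs).trans hD)

theorem exists_coord_eq_norm {n : ℕ} (x : Fin n → ℝ) (hx : 1 ≤ ‖x‖) : ∃ i, |x i| = ‖x‖ := by
  by_contra h
  push Not at h
  have : ‖x‖ < ‖x‖ := by
    rw [pi_norm_lt_iff (by linarith)]
    exact fun i => lt_of_le_of_ne (norm_le_pi_norm x i) (h i)
  exact lt_irrefl _ this

theorem brouwer_zero {n : ℕ} (H : (Fin n → ℝ) → (Fin n → ℝ)) (hH : Continuous H)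
    (h1 : ∀ x, ‖H x - x‖ ≤ 1) : ∃ x, ‖x‖ ≤ 1 ∧ H x = 0 := by
  by_contra hcon
  push Not at hcon
  obtain ⟨δ, hδ, hmin⟩ : ∃ δ > 0, ∀ x, ‖x‖ ≤ 1 → δ ≤ ‖H x‖ := by
    obtain ⟨x0, hx0, hm⟩ := (isCompact_closedBall (0 : Fin n → ℝ) 1).exists_isMinOn
      ⟨0, by simp⟩ hH.norm.continuousOn
    refine ⟨‖H x0‖, norm_pos_iff.2 (hcon x0 (by simpa using hx0)), fun x hx => ?_⟩
    exact hm (by simpa using hx)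
  obtain ⟨F, hF⟩ := poly_approx (Metric.closedBall 0 2) (isCompact_closedBall _ _)
    (fun x => H x + (δ / 4) • x) (by fun_prop) (δ / 8) (by positivity)
  have hF' : ∀ x : Fin n → ℝ, ‖x‖ ≤ 2 → ∀ i, |MvPolynomial.eval x (F i) - (H x i + δ / 4 * x i)| < δ / 8 := by
    intro x hx i
    simpa using hF x (by simpa using hx) i
  let D := Finset.univ.sup fun i => (F i).totalDegree
  choose C hC using fun i => poly_growth (F i) D
    (Finset.le_sup (f := fun i => (F i).totalDegree) (Finset.mem_univ i))
  let C0 := ∑ i, |C i|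
  obtain ⟨j, hj⟩ := pow_unbounded_of_one_lt (C0 / (δ / 8)) (one_lt_two)
  let K := 2 * (D + j) + 1
  have hKo : Odd K := ⟨D + j, rfl⟩
  obtain ⟨x, hx⟩ := real_zero K hKo (fun i => MvPolynomial.C (δ / 8)⁻¹ * F i) (by
    intro i
    refine (MvPolynomial.totalDegree_mul _ _).trans_lt ?_
    rw [MvPolynomial.totalDegree_C, zero_add]
    have : (F i).totalDegree ≤ D :=
      (Finset.le_sup (f := fun i => (F i).totalDegree) (Finset.mem_univ i))
    omega)
  have hx' : ∀ i, MvPolynomial.eval x (F i) = - (δ / 8 * x i ^ K) := by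
    intro i
    have := hx i
    simp only [map_mul, MvPolynomial.eval_C] at this
    field_simp at this
    linarith
  rcases lt_or_ge ‖x‖ 1 with hlt | hge
  · have : ‖H x‖ ≤ δ / 2 := by
      rw [pi_norm_le_iff_of_nonneg (by positivity)]
      intro i
      have h2 := hF' x (by linarith) i
      have h3 : |x i| ≤ 1 := (norm_le_pi_norm x i).trans hlt.le
      have h4 : |x i ^ K| ≤ 1 := by rw [abs_pow]; exact pow_le_one₀ (abs_nonneg _) h3
      rw [hx'] at h2
      rw [Real.norm_eq_abs]
      rw [abs_lt] at h2
      rw [abs_le] at *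
      constructor <;> nlinarith
    have := hmin x hlt.le
    linarith
  · obtain ⟨i, hi⟩ := exists_coord_eq_norm x hge
    rcases le_or_gt ‖x‖ 2 with h2 | h2
    · have h3 := hF' x h2 i
      have h4 : |H x i - x i| ≤ 1 := (norm_le_pi_norm (H x - x) i).trans (h1 x)
      rw [hx'] at h3
      have h5 : 0 ≤ x i * x i ^ K := by
        rw [← pow_succ']
        exact (hKo.add_one).pow_nonneg _
      rw [← hi] at hge
      rw [abs_lt] at h3
      rw [abs_le] at h4
      rcases le_total 0 (x i) with h6 | h6
      · rw [abs_of_nonneg h6] at hge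
        have : 0 ≤ x i ^ K := pow_nonneg h6 _
        nlinarith
      · rw [abs_of_nonpos h6] at hge
        have : x i ^ K ≤ 0 := hKo.pow_nonpos h6
        nlinarith
    · have h3 := hC i x hge
      rw [hx', abs_neg, abs_mul, abs_pow, hi, abs_of_pos (by positivity : 0 < δ / 8)] at h3
      have h4 : C i ≤ C0 := (le_abs_self _).trans
        (Finset.single_le_sum (f := fun i => |C i|) (fun _ _ => abs_nonneg _) (Finset.mem_univ i))
      have hK' : K = (K - D) + D := by omega
      rw [hK', pow_add] at h3
      have hpos : 0 < ‖x‖ ^ D := by positivity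
      rw [← mul_assoc] at h3
      have h5 := le_of_mul_le_mul_right h3 hpos
      have h6 : (2:ℝ) ^ j ≤ ‖x‖ ^ (K - D) :=
        (pow_le_pow_left₀ (by norm_num) h2.le j).trans (pow_le_pow_right₀ hge (by omega))
      rw [div_lt_iff₀ (by positivity)] at hj
      nlinarith

theorem brouwer_zero_ball {n : ℕ} (H : (Fin n → ℝ) → (Fin n → ℝ))
    (hH : ContinuousOn H (Metric.closedBall 0 1))
    (h1 : ∀ x ∈ Metric.closedBall (0 : Fin n → ℝ) 1, ‖H x - x‖ ≤ 1) :
    ∃ x ∈ Metric.closedBall (0 : Fin n → ℝ) 1, H x = 0 := by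
  let π : (Fin n → ℝ) → (Fin n → ℝ) := fun x i => max (-1) (min 1 (x i))
  have hπ : Continuous π := by fun_prop
  have hm : ∀ x, π x ∈ Metric.closedBall (0 : Fin n → ℝ) 1 := by
    intro x
    rw [mem_closedBall_zero_iff, pi_norm_le_iff_of_nonneg zero_le_one]
    intro i
    rw [Real.norm_eq_abs, abs_le]
    exact ⟨le_max_left _ _, max_le (by norm_num) (min_le_left _ _)⟩
  have hid : ∀ x, ‖x‖ ≤ 1 → π x = x := by
    intro x hx
    ext i
    have := (norm_le_pi_norm x i).trans hx
    rw [Real.norm_eq_abs, abs_le] at this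
    simp [π, this.1, this.2]
  obtain ⟨x, hx, h⟩ := brouwer_zero (fun x => H (π x) + (x - π x))
    ((hH.comp_continuous hπ hm).add (continuous_id.sub hπ)) (by
      intro x
      have := h1 _ (hm x)
      rwa [show H (π x) + (x - π x) - x = H (π x) - π x by abel])
  simp only [hid x hx, sub_self, add_zero] at h
  exact ⟨x, by simpa using hx, h⟩

theorem invariance_of_domain {n : ℕ} (f : (Fin n → ℝ) → (Fin n → ℝ))
    (hf : ContinuousOn f (Metric.closedBall 0 1)) (hinj : Set.InjOn f (Metric.closedBall 0 1)) :
    f 0 ∈ interior (f '' Metric.closedBall 0 1) := by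
  set B := Metric.closedBall (0 : Fin n → ℝ) 1 with hB
  have hBc : IsCompact B := isCompact_closedBall _ _
  have h0B : (0 : Fin n → ℝ) ∈ B := by simp [hB]
  have hcpt : IsCompact (f '' B) := hBc.image_of_continuousOn hf
  obtain ⟨G, hG⟩ : ∃ G : C(Fin n → ℝ, Fin n → ℝ), ∀ x ∈ B, G (f x) = x := by
    have : CompactSpace B := isCompact_iff_compactSpace.1 hBc
    have he : Topology.IsClosedEmbedding (B.domRestrict f) :=
      (continuousOn_iff_continuous_domRestrict.1 hf).isClosedEmbedding (Set.injOn_iff_injective.1 hinj)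
    obtain ⟨G, hG⟩ := ContinuousMap.exists_extension' he
      (⟨Subtype.val, continuous_subtype_val⟩ : C(B, Fin n → ℝ))
    exact ⟨G, fun x hx => congrFun hG ⟨x, hx⟩⟩
  have stab : ∀ Gt : (Fin n → ℝ) → (Fin n → ℝ), ContinuousOn Gt (f '' B) →
      (∀ y ∈ f '' B, ‖Gt y - G y‖ ≤ 1) → ∃ y ∈ f '' B, Gt y = 0 := by
    intro Gt hc hGt
    obtain ⟨x, hx, h⟩ := brouwer_zero_ball (Gt ∘ f) (hc.comp hf (Set.mapsTo_image f B)) (by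
      intro x hx
      have := hGt (f x) ⟨x, hx, rfl⟩
      rwa [hG x hx] at this)
    exact ⟨f x, ⟨x, hx, rfl⟩, h⟩
  have hG0 : G (f 0) = 0 := hG 0 h0B
  obtain ⟨r, hr, hGr⟩ := Metric.continuousAt_iff.1 (G.continuous.continuousAt (x := f 0)) (1/10)
    (by norm_num)
  by_contra hnot
  let ε := r / 2
  have hε : 0 < ε := by positivity
  obtain ⟨c, hcB, hcε⟩ : ∃ c, c ∉ f '' B ∧ dist c (f 0) < ε := by
    by_contra h
    push Not at h
    apply hnot
    rw [mem_interior_iff_mem_nhds]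
    refine Filter.mem_of_superset (Metric.ball_mem_nhds _ hε) fun y hy => ?_
    by_contra hy'
    exact absurd (h y hy') (not_le.2 hy)
  have hsmall : ∀ y, dist y c ≤ ε → ‖G y‖ ≤ 1 / 10 := by
    intro y hy
    have := hGr (x := y) (by
      have := dist_triangle y c (f 0)
      have : ε + ε = r := by simp [ε]
      linarith)
    rw [hG0, dist_zero_right] at this
    exact this.le
  let S1 := f '' B ∩ {y | ε ≤ dist y c}
  let S2 := Metric.sphere c ε
  have hS1 : IsCompact S1 :=
    hcpt.inter_right (isClosed_le continuous_const (continuous_id.dist continuous_const))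
  have hS2 : IsCompact S2 := isCompact_sphere c ε
  have hGS1 : ∀ y ∈ S1, G y ≠ 0 := by
    rintro _ ⟨⟨x, hx, rfl⟩, hd⟩ h0
    rw [hG x hx] at h0
    rw [h0, Set.mem_ofPred_eq, dist_comm] at hd
    linarith
  obtain ⟨δ, hδ, hδ1, hmin⟩ : ∃ δ > 0, δ ≤ 1 / 10 ∧ ∀ y ∈ S1, δ ≤ ‖G y‖ := by
    rcases S1.eq_empty_or_nonempty with h | h
    · exact ⟨1/10, by norm_num, le_rfl, by simp [h]⟩
    · obtain ⟨x0, hx0, hm⟩ := hS1.exists_isMinOn h G.continuous.norm.continuousOn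
      refine ⟨min (1/10) ‖G x0‖, lt_min (by norm_num) (norm_pos_iff.2 (hGS1 x0 hx0)),
        min_le_left _ _, fun x hx => (min_le_right _ _).trans (hm hx)⟩
  obtain ⟨F, hF⟩ := poly_approx (S1 ∪ S2) (hS1.union hS2) G G.continuous (δ / 2) (by positivity)
  let P : (Fin n → ℝ) → (Fin n → ℝ) := fun x i => MvPolynomial.eval x (F i)
  have hPG : ∀ x ∈ S1 ∪ S2, ‖P x - G x‖ ≤ δ / 2 := by
    intro x hx
    rw [pi_norm_le_iff_of_nonneg (by positivity)]
    exact fun i => (hF x hx i).le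
  have hPd : Differentiable ℝ P := by
    rw [differentiable_pi]
    intro i
    have : ∀ p : MvPolynomial (Fin n) ℝ, Differentiable ℝ fun x : Fin n → ℝ => MvPolynomial.eval x p := by
      intro p
      induction p using MvPolynomial.induction_on with
      | C a => simp
      | add p q hp hq => simpa using! hp.add hq
      | mul_X p i hp => simpa using! hp.mul (differentiable_apply i)
    exact this (F i)
  obtain ⟨v, hv, hvP⟩ : ∃ v : Fin n → ℝ, ‖v‖ < δ / 2 ∧ v ∉ P '' S2 := by
    have hz : MeasureTheory.volume (P '' S2) = 0 :=
      MeasureTheory.addHaar_image_eq_zero_of_differentiableOn_of_addHaar_eq_zero _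
        hPd.differentiableOn (MeasureTheory.Measure.addHaar_sphere_of_ne_zero _ _ hε.ne')
    by_contra h
    push Not at h
    have hsub : Metric.ball (0 : Fin n → ℝ) (δ / 2) ⊆ P '' S2 := fun v hv => h v (by simpa using hv)
    have := MeasureTheory.measure_mono_null hsub hz
    exact (Metric.measure_ball_pos MeasureTheory.volume (0 : Fin n → ℝ) (by positivity : 0 < δ / 2)).ne' this
  have hQG : ∀ x ∈ S1 ∪ S2, ‖(P x - v) - G x‖ < δ := by
    intro x hx
    have h1 := hPG x hx
    have h2 := norm_sub_le (P x - G x) v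
    rw [show P x - v - G x = P x - G x - v by abel]
    linarith
  have hQ0 : ∀ x ∈ S1 ∪ S2, P x - v ≠ 0 := by
    rintro x hx h0
    have h1 := hQG x hx
    rw [h0, zero_sub, norm_neg] at h1
    rcases hx with hx | hx
    · exact absurd (hmin x hx) (not_le.2 h1)
    · exact hvP ⟨x, hx, sub_eq_zero.1 h0⟩
  let Φ : (Fin n → ℝ) → (Fin n → ℝ) := fun y => c + (max (ε / ‖y - c‖) 1) • (y - c)
  have hne : ∀ y ∈ f '' B, ‖y - c‖ ≠ 0 := by
    intro y hy h
    rw [norm_eq_zero, sub_eq_zero] at h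
    exact hcB (h ▸ hy)
  have hΦc : ContinuousOn Φ (f '' B) := by
    apply ContinuousOn.add continuousOn_const
    refine ContinuousOn.fun_smul ?_ ?_
    · exact ContinuousOn.sup (continuousOn_const.div (by fun_prop) hne) continuousOn_const
    · fun_prop
  have hΦ1 : ∀ y ∈ f '' B, ε ≤ dist y c → Φ y = y := by
    intro y hy h
    have : ε / ‖y - c‖ ≤ 1 := by
      rw [dist_eq_norm] at h
      exact div_le_one_of_le₀ h (norm_nonneg _)
    simp [Φ, max_eq_right this]
  have hΦ2 : ∀ y ∈ f '' B, dist y c ≤ ε → Φ y ∈ S2 := by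
    intro y hy h
    have hp : 0 < ‖y - c‖ := lt_of_le_of_ne (norm_nonneg _) (hne y hy).symm
    have : 1 ≤ ε / ‖y - c‖ := by
      rw [dist_eq_norm] at h
      rwa [one_le_div hp]
    simp only [S2, Φ, mem_sphere_iff_norm, add_sub_cancel_left, max_eq_left this, norm_smul]
    rw [Real.norm_eq_abs, abs_of_pos (by positivity)]
    field_simp
  have hΦm : ∀ y ∈ f '' B, Φ y ∈ S1 ∪ S2 := by
    intro y hy
    rcases le_total ε (dist y c) with h | h
    · left; rw [hΦ1 y hy h]; exact ⟨hy, h⟩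
    · right; exact hΦ2 y hy h
  obtain ⟨y, hy, h0⟩ := stab (fun y => P (Φ y) - v)
    ((hPd.continuous.comp_continuousOn hΦc).sub continuousOn_const) (by
      intro y hy
      have h1 := hQG _ (hΦm y hy)
      rcases le_total ε (dist y c) with h | h
      · rw [hΦ1 y hy h] at h1 ⊢
        linarith
      · have h2 := hsmall y h
        have h3 := hsmall (Φ y) (le_of_eq (hΦ2 y hy h))
        have e : P (Φ y) - v - G y = (P (Φ y) - v - G (Φ y)) + G (Φ y) - G y := by abel
        have h4 := norm_sub_le ((P (Φ y) - v - G (Φ y)) + G (Φ y)) (G y)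
        have h5 := norm_add_le (P (Φ y) - v - G (Φ y)) (G (Φ y))
        rw [e]
        linarith)
  exact hQ0 _ (hΦm y hy) h0

theorem stmt_1 (m d : ℕ) (hm : Odd m) (h2 : 2 ≤ m) (hd : d ≤ m)
    (f : Metric.sphere (0 : EuclideanSpace ℝ (Fin (m+1))) 1 → EuclideanSpace ℝ (Fin d))
    (hf : Continuous f) (hodd : ∀ p, f (-p) = -f p) :
    ∃ p₁ p₂ : Metric.sphere (0 : EuclideanSpace ℝ (Fin (m+1))) 1,
      p₁ ≠ p₂ ∧ p₁ ≠ -p₂ ∧ f p₁ = f p₂ := by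
  by_contra hcon
  push Not at hcon
  have hfib : ∀ p q, f p = f q → p = q ∨ p = -q := by
    intro p q h
    by_contra hne
    push Not at hne
    exact hcon p q hne.1 hne.2 h
  let F : Metric.sphere (0 : EuclideanSpace ℝ (Fin (m+1))) 1 → (Fin m → ℝ) :=
    fun p i => if h : i.1 < d then f p ⟨i.1, h⟩ else 0
  have hFc : Continuous F := by
    refine continuous_pi fun i => ?_
    by_cases h : i.1 < d
    · simp only [F, h, dite_true]
      fun_prop
    · simp only [F, h, dite_false]
      fun_prop
  have hFodd : ∀ p, F (-p) = - F p := by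
    intro p
    ext i
    by_cases h : i.1 < d <;> simp [F, h, hodd]
  have hFf : ∀ p q, F p = F q → f p = f q := by
    intro p q h
    ext j
    have := congrFun h ⟨j.1, j.2.trans_le hd⟩
    simpa [F] using this
  have : Fact (Module.finrank ℝ (EuclideanSpace ℝ (Fin (m+1))) = m + 1) := ⟨by simp⟩
  have loc : ∀ p : Metric.sphere (0 : EuclideanSpace ℝ (Fin (m+1))) 1,
      F p ∈ interior (F '' {q | 0 < inner ℝ (q : EuclideanSpace ℝ (Fin (m+1))) p.1}) := by
    intro p
    let σ := stereographic' m (-p)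
    have hσt : σ.target = Set.univ := stereographic'_target _
    have hp : p ∈ σ.source := by
      rw [stereographic'_source]
      intro h
      have h : p = -p := h
      have h' : p.1 = -p.1 := congrArg Subtype.val h
      have h1 : ‖p.1‖ = 1 := by simp
      have h0 : p.1 = 0 := by
        have h2 : (2:ℝ) • p.1 = 0 := by rw [two_smul]; nth_rewrite 2 [h']; simp
        exact (smul_eq_zero.1 h2).resolve_left two_ne_zero
      rw [h0] at h1
      simp at h1
    let ψ : (Fin m → ℝ) → Metric.sphere (0 : EuclideanSpace ℝ (Fin (m+1))) 1 :=
      fun x => σ.symm (σ p + WithLp.toLp 2 x)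
    have hψc : Continuous ψ := by
      have : Continuous σ.symm := by
        rw [← continuousOn_univ, ← hσt]
        exact σ.continuousOn_symm
      fun_prop
    have hψi : Function.Injective ψ := by
      intro x y h
      have := σ.symm.injOn (by simp [hσt]) (by simp [hσt]) h
      simpa using this
    have hψ0 : ψ 0 = p := by
      simp only [ψ, WithLp.toLp_zero, add_zero]
      exact σ.left_inv hp
    have hev : ∀ᶠ x in nhds (0 : Fin m → ℝ),
        0 < inner ℝ (ψ x : EuclideanSpace ℝ (Fin (m+1))) p.1 := by
      have hc : Continuous fun x => inner ℝ (ψ x : EuclideanSpace ℝ (Fin (m+1))) p.1 := by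
        fun_prop
      apply hc.continuousAt.eventually_const_lt
      beta_reduce
      rw [hψ0, real_inner_self_eq_norm_sq]
      simp
    obtain ⟨r, hr, hrs⟩ := Metric.nhds_basis_closedBall.eventually_iff.1 hev
    have hin : ∀ x ∈ Metric.closedBall (0 : Fin m → ℝ) 1,
        0 < inner ℝ (ψ (r • x) : EuclideanSpace ℝ (Fin (m+1))) p.1 := by
      intro x hx
      apply hrs
      rw [mem_closedBall_zero_iff] at *
      rw [norm_smul, Real.norm_eq_abs, abs_of_pos hr]
      nlinarith
    have key := invariance_of_domain (fun x => F (ψ (r • x)))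
      (by fun_prop) (by
        intro x hx y hy h
        rcases hfib _ _ (hFf _ _ h) with h | h
        · exact smul_right_injective _ hr.ne' (hψi h)
        · have h1 := hin x hx
          have h2 := hin y hy
          rw [h] at h1
          change 0 < inner ℝ (-(ψ (r • y) : EuclideanSpace ℝ (Fin (m+1)))) p.1 at h1
          rw [inner_neg_left] at h1
          linarith)
    simp only [smul_zero, hψ0] at key
    refine interior_mono ?_ key
    rintro _ ⟨x, hx, rfl⟩
    exact ⟨_, hin x hx, rfl⟩
  have hopen : IsOpen (Set.range F) := by
    rw [← subset_interior_iff_isOpen]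
    rintro _ ⟨p, rfl⟩
    exact interior_mono (Set.image_subset_range _ _) (loc p)
  have hclosed : IsClosed (Set.range F) := (isCompact_range hFc).isClosed
  have hne : (Set.range F).Nonempty := by
    have : Nonempty (Metric.sphere (0 : EuclideanSpace ℝ (Fin (m+1))) 1) :=
      (NormedSpace.sphere_nonempty.2 zero_le_one).to_subtype
    exact Set.range_nonempty F
  have huniv : Set.range F = Set.univ := IsClopen.eq_univ ⟨hclosed, hopen⟩ hne
  obtain ⟨p, hp⟩ : (0 : Fin m → ℝ) ∈ Set.range F := by rw [huniv]; trivial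
  have hA := loc p
  have hB := loc (-p)
  rw [hFodd, hp, neg_zero] at hB
  rw [hp] at hA
  rw [mem_interior_iff_mem_nhds] at hA hB
  have : Nonempty (Fin m) := ⟨⟨0, by omega⟩⟩
  have hnb : (nhdsWithin (0 : Fin m → ℝ) {0}ᶜ).NeBot := inferInstance
  obtain ⟨y, ⟨⟨q, hq, hqy⟩, ⟨q', hq', hqy'⟩⟩, hy0⟩ :=
    hnb.nonempty_of_mem (Filter.inter_mem (mem_nhdsWithin_of_mem_nhds (Filter.inter_mem hA hB))
      self_mem_nhdsWithin)
  have hq : 0 < inner ℝ (q : EuclideanSpace ℝ (Fin (m+1))) p.1 := hq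
  have hq' : 0 < inner ℝ (q' : EuclideanSpace ℝ (Fin (m+1))) (-p.1) := hq'
  rw [inner_neg_right] at hq'
  rcases hfib q q' (hFf _ _ (hqy.trans hqy'.symm)) with h | h
  · rw [h] at hq
    linarith
  · rw [h, hFodd, hqy'] at hqy
    exact hy0 (self_eq_neg.1 hqy.symm)
end

section
/- Let f : S^m → ℝ^d be a continuous map with m > d. Then there exists a point p₀ ∈ S^m with f(p₀) = f(-p₀), and additionally there exists a pair p₁, p₂ ∈ S^m with p₁ ≠ ±p₂ and f(p₁) = f(p₂). -/
namespace BU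

/-- mod 2 chains on ordered tuples of points -/
abbrev Ch (V : Type) := List V →₀ ZMod 2

variable {V : Type}

noncomputable def gen (l : List V) : Ch V := Finsupp.single l 1

noncomputable def cone (v : V) : Ch V →ₗ[ZMod 2] Ch V :=
  Finsupp.linearCombination (ZMod 2) (fun l => gen (v :: l))

noncomputable def bdL : List V → Ch V
  | [] => 0
  | v :: l => gen l + cone v (bdL l)

noncomputable def bd : Ch V →ₗ[ZMod 2] Ch V := Finsupp.linearCombination (ZMod 2) bdL

noncomputable def mp (a : V → V) : Ch V →ₗ[ZMod 2] Ch V :=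
  Finsupp.linearCombination (ZMod 2) (fun l => gen (l.map a))

noncomputable def prL (a b : V → V) : List V → Ch V
  | [] => 0
  | v :: l => gen (a v :: b v :: l.map b) + cone (a v) (prL a b l)

noncomputable def pr (a b : V → V) : Ch V →ₗ[ZMod 2] Ch V :=
  Finsupp.linearCombination (ZMod 2) (prL a b)

def thL : List (V → ZMod 2) → List V → ZMod 2
  | [], [_] => 1
  | s :: S, u :: v :: l => (s u + s v) * thL S (v :: l)
  | _, _ => 0

noncomputable def th (S : List (V → ZMod 2)) : Ch V →ₗ[ZMod 2] ZMod 2 :=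
  Finsupp.linearCombination (ZMod 2) (thL S)

def psL (s : V → ZMod 2) (S : List (V → ZMod 2)) : List V → ZMod 2
  | [] => 0
  | u :: l => s u * thL S (u :: l)

noncomputable def ps (s : V → ZMod 2) (S : List (V → ZMod 2)) : Ch V →ₗ[ZMod 2] ZMod 2 :=
  Finsupp.linearCombination (ZMod 2) (psL s S)

@[simp] lemma cone_gen (v : V) (l) : cone v (gen l) = gen (v :: l) := by simp [cone, gen]
@[simp] lemma bd_nil : bd (gen ([] : List V)) = 0 := by simp [bd, gen, bdL]
@[simp] lemma bd_cons (v : V) (l) : bd (gen (v :: l)) = gen l + cone v (bd (gen l)) := by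
  simp [bd, gen, bdL]
@[simp] lemma mp_gen (a : V → V) (l) : mp a (gen l) = gen (l.map a) := by simp [mp, gen]
@[simp] lemma pr_nil (a b : V → V) : pr a b (gen []) = 0 := by simp [pr, gen, prL]
@[simp] lemma pr_cons (a b : V → V) (v l) : pr a b (gen (v :: l)) =
    gen (a v :: b v :: l.map b) + cone (a v) (pr a b (gen l)) := by simp [pr, gen, prL]
@[simp] lemma th_gen (S : List (V → ZMod 2)) (l) : th S (gen l) = thL S l := by simp [th, gen]
@[simp] lemma ps_gen (s) (S : List (V → ZMod 2)) (l) : ps s S (gen l) = psL s S l := by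
  simp [ps, gen]

lemma hom_ext {M : Type} [AddCommGroup M] [Module (ZMod 2) M] {f g : Ch V →ₗ[ZMod 2] M}
    (h : ∀ l, f (gen l) = g (gen l)) : f = g := by
  apply Finsupp.lhom_ext'
  intro l
  ext
  simpa [gen] using h l

lemma dbl {M : Type} [AddCommGroup M] [Module (ZMod 2) M] (x : M) : x + x = 0 := by
  have : (2 : ZMod 2) • x = 0 := by
    rw [show (2 : ZMod 2) = 0 from rfl, zero_smul]
  rwa [two_smul] at this

lemma bd_cone (v : V) (c : Ch V) : bd (cone v c) = c + cone v (bd c) := by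
  have : bd ∘ₗ cone v = LinearMap.id + cone v ∘ₗ bd := hom_ext (by intro l; simp)
  simpa using LinearMap.congr_fun this c

lemma mp_cone (a : V → V) (v : V) (c : Ch V) : mp a (cone v c) = cone (a v) (mp a c) := by
  have : mp a ∘ₗ cone v = cone (a v) ∘ₗ mp a := hom_ext (by intro l; simp)
  simpa using LinearMap.congr_fun this c

lemma pr_cone (a b : V → V) (v : V) (c : Ch V) : pr a b (cone v c) =
    cone (a v) (cone (b v) (mp b c)) + cone (a v) (pr a b c) := by
  have : pr a b ∘ₗ cone v = cone (a v) ∘ₗ cone (b v) ∘ₗ mp b + cone (a v) ∘ₗ pr a b :=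
    hom_ext (by intro l; simp)
  simpa using LinearMap.congr_fun this c

lemma mp_bd (a : V → V) (c : Ch V) : mp a (bd c) = bd (mp a c) := by
  have : mp a ∘ₗ bd = bd ∘ₗ mp a := by
    refine hom_ext fun l => ?_
    induction l with
    | nil => simp
    | cons v l ih =>
      simp only [LinearMap.comp_apply, mp_gen] at ih
      simp [mp_cone, ih]
  simpa using LinearMap.congr_fun this c

lemma bd_pr (a b : V → V) (c : Ch V) :
    bd (pr a b c) = mp a c + mp b c + pr a b (bd c) := by
  have : bd ∘ₗ pr a b = mp a + mp b + pr a b ∘ₗ bd := by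
    refine hom_ext fun l => ?_
    induction l with
    | nil => simp [dbl]
    | cons v l ih =>
      simp only [LinearMap.comp_apply, mp_gen, LinearMap.add_apply] at ih
      simp only [LinearMap.comp_apply, LinearMap.add_apply, pr_cons, map_add, bd_cons, bd_cone,
        ih, mp_gen, pr_cone, mp_bd, cone_gen, List.map_cons]
      have h1 := dbl (gen (a v :: l.map b))
      have key : ∀ A B C D E F : Ch V, C + C = 0 → A + (C + D) + (E + (B + C + F)) =
          B + A + (E + (D + F)) := by
        intro A B C D E F h
        have : A + (C + D) + (E + (B + C + F)) = B + A + (E + (D + F)) + (C + C) := by abel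
        rw [this, h, add_zero]
      exact key _ _ _ _ _ _ h1
  simpa using LinearMap.congr_fun this c

lemma th_cone2 (s) (S : List (V → ZMod 2)) (u v : V) (c : Ch V) :
    th (s :: S) (cone u (cone v c)) = (s u + s v) * th S (cone v c) := by
  have : th (s :: S) ∘ₗ cone u ∘ₗ cone v = (s u + s v) • (th S ∘ₗ cone v) :=
    hom_ext (by intro l; simp [thL])
  simpa using LinearMap.congr_fun this c

lemma ps_cone (s) (S : List (V → ZMod 2)) (u : V) (c : Ch V) :
    ps s S (cone u c) = s u * th S (cone u c) := by
  have : ps s S ∘ₗ cone u = s u • (th S ∘ₗ cone u) :=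
    hom_ext (by intro l; simp [psL])
  simpa using LinearMap.congr_fun this c

lemma z2 (x : ZMod 2) : x + x = 0 := dbl x

lemma th_nil_cone2 (u v : V) (c : Ch V) : th [] (cone u (cone v c)) = 0 := by
  have : th [] ∘ₗ cone u ∘ₗ cone v = 0 := hom_ext (by intro l; simp [thL])
  simpa using LinearMap.congr_fun this c

lemma th_bd (S : List (V → ZMod 2)) (l : List V) : th S (bd (gen l)) = 0 := by
  induction S generalizing l with
  | nil =>
    match l with
    | [] => simp
    | [u] => simp [thL]
    | [u, v] => simp [thL, z2]
    | u :: v :: w :: l => simp [thL, th_nil_cone2]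
  | cons s S ih =>
    match l with
    | [] => simp
    | [u] => simp [thL]
    | [u, v] => simp [thL]
    | u :: v :: w :: l =>
      have h := ih (v :: w :: l)
      rw [bd_cons, map_add, th_gen] at h
      rw [bd_cons, bd_cons v, map_add, map_add, map_add, th_cone2, cone_gen, th_gen, th_gen]
      simp only [thL]
      linear_combination (s u + s v) * h + z2 (s w * thL S (w :: l)) 

lemma ps_bd (s) (S : List (V → ZMod 2)) (c : Ch V) : ps s S (bd c) = th (s :: S) c := by
  have : ps s S ∘ₗ bd = th (s :: S) := by
    refine hom_ext fun l => ?_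
    match l with
    | [] => simp [thL]
    | [u] => simp [thL, psL]
    | u :: v :: l =>
      have h := th_bd S (u :: v :: l)
      rw [bd_cons, map_add, th_gen] at h
      rw [LinearMap.comp_apply, bd_cons, map_add, ps_cone, ps_gen, th_gen]
      simp only [thL, psL]
      linear_combination (s u) * h + z2 (s u * thL S (v :: l)) * (-1)
  simpa using LinearMap.congr_fun this c

/-- supported chains -/
noncomputable def sup (A : Set (List V)) : Submodule (ZMod 2) (Ch V) := Submodule.span _ (Set.image gen A)

lemma sup_map {M : Type} [AddCommGroup M] [Module (ZMod 2) M] {A : Set (List V)}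
    {f : Ch V →ₗ[ZMod 2] M} {B : Submodule (ZMod 2) M}
    (h : ∀ l ∈ A, f (gen l) ∈ B) {c : Ch V} (hc : c ∈ sup A) : f c ∈ B := by
  have : sup A ≤ B.comap f := by
    rw [sup, Submodule.span_le]
    rintro _ ⟨l, hl, rfl⟩
    exact h l hl
  exact this hc

lemma sup_eq {M : Type} [AddCommGroup M] [Module (ZMod 2) M] {A : Set (List V)}
    {f g : Ch V →ₗ[ZMod 2] M}
    (h : ∀ l ∈ A, f (gen l) = g (gen l)) {c : Ch V} (hc : c ∈ sup A) : f c = g c := by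
  have : c ∈ sup A → (f - g) c ∈ (⊥ : Submodule (ZMod 2) M) :=
    sup_map (by intro l hl; simp [h l hl])
  have := this hc
  simpa [sub_eq_zero] using this

lemma gen_mem {A : Set (List V)} {l : List V} (h : l ∈ A) : gen l ∈ sup A :=
  Submodule.subset_span ⟨l, h, rfl⟩

/-- good lists -/
def Gd [Dist V] (K : Set V) (η : ℝ) : Set (List V) :=
  {l | l.IsChain (fun x y => dist x y ≤ η) ∧ ∀ x ∈ l, x ∈ K}

lemma pr_sup [Dist V] {K K' : Set V} {η : ℝ} {a b : V → V}
    (ha : ∀ x ∈ K, a x ∈ K') (hb : ∀ x ∈ K, b x ∈ K')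
    (hac : ∀ x ∈ K, ∀ y ∈ K, dist (a x) (a y) ≤ dist x y)
    (hbc : ∀ x ∈ K, ∀ y ∈ K, dist (b x) (b y) ≤ dist x y)
    (hab : ∀ x ∈ K, dist (a x) (b x) ≤ η) {c : Ch V} (hc : c ∈ sup (Gd K η)) :
    pr a b c ∈ sup (Gd K' η) := by
  have hbl : ∀ l ∈ Gd K η, l.map b ∈ Gd K' η := by
    intro l
    induction l with
    | nil => intro _; simp [Gd]
    | cons v l ih =>
      rintro ⟨h1, h2⟩
      rw [List.isChain_cons] at h1
      have := ih ⟨h1.2, fun x hx => h2 x (by simp [hx])⟩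
      refine ⟨?_, ?_⟩
      · rw [List.map_cons, List.isChain_cons]
        refine ⟨?_, this.1⟩
        intro y hy
        cases l with
        | nil => simp at hy
        | cons w l =>
          simp at hy; subst hy
          exact (hbc _ (h2 _ (by simp)) _ (h2 _ (by simp))).trans (h1.1 w (by simp))
      · intro x hx
        simp only [List.mem_map] at hx
        obtain ⟨y, hy, rfl⟩ := hx
        exact hb _ (h2 _ hy)
  -- stronger: all lists start with `a` of the head
  have key : ∀ l ∈ Gd K η, pr a b (gen l) ∈
      sup {l' | l' ∈ Gd K' η ∧ ∀ y ∈ l'.head?, ∃ v ∈ l.head?, y = a v} := by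
    intro l
    induction l with
    | nil => intro _; simp
    | cons v l ih =>
      intro hl
      have hl' := hl
      obtain ⟨h1, h2⟩ := hl
      rw [List.isChain_cons] at h1
      have hv : v ∈ K := h2 _ (by simp)
      have ht := ih ⟨h1.2, fun x hx => h2 x (by simp [hx])⟩
      rw [pr_cons]
      refine Submodule.add_mem _ (gen_mem ?_) (sup_map ?_ ht)
      · have hm := hbl _ hl'
        refine ⟨⟨?_, ?_⟩, by simp⟩
        · rw [List.isChain_cons]
          exact ⟨by simpa using hab v hv, hm.1⟩
        · intro x hx
          rw [List.mem_cons] at hx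
          rcases hx with rfl | hx
          · exact ha _ hv
          · exact hm.2 x hx
      · rintro l' ⟨⟨h3, h4⟩, h5⟩
        rw [cone_gen]
        refine gen_mem ⟨⟨?_, ?_⟩, by simp⟩
        · rw [List.isChain_cons]
          refine ⟨?_, h3⟩
          intro y hy
          obtain ⟨w, hw, rfl⟩ := h5 y hy
          have hwl : w ∈ l := List.mem_of_mem_head? hw
          exact (hac _ hv _ (h2 _ (by simp [hwl]))).trans (h1.1 w hw)
        · intro x hx
          rw [List.mem_cons] at hx
          rcases hx with rfl | hx
          · exact ha _ hv
          · exact h4 x hx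
  have h2 : ∀ l ∈ Gd K η, pr a b (gen l) ∈ sup (Gd K' η) := fun l hl =>
    (Submodule.span_mono (Set.image_mono (fun l' h => h.1))) (key l hl)
  exact sup_map h2 hc


lemma mp_mp (a b : V → V) (c : Ch V) : mp a (mp b c) = mp (a ∘ b) c := by
  have : mp a ∘ₗ mp b = mp (a ∘ b) := hom_ext (by intro l; simp)
  simpa using LinearMap.congr_fun this c

lemma mp_id' {a : V → V} (h : ∀ x, a x = x) (c : Ch V) : mp a c = c := by
  have ha : a = id := funext h
  subst ha
  have : mp (id : V → V) = LinearMap.id := hom_ext (by intro l; simp)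
  simpa using LinearMap.congr_fun this c

lemma mp_sup [Dist V] {K K' : Set V} {η : ℝ} {b : V → V}
    (hb : ∀ x ∈ K, b x ∈ K')
    (hbc : ∀ x ∈ K, ∀ y ∈ K, dist (b x) (b y) ≤ dist x y)
    {c : Ch V} (hc : c ∈ sup (Gd K η)) :
    mp b c ∈ sup (Gd K' η) := by
  refine sup_map (fun l hl => ?_) hc
  rw [mp_gen]
  refine gen_mem ?_
  induction l with
  | nil => simp [Gd]
  | cons v l ih =>
    obtain ⟨h1, h2⟩ := hl
    rw [List.isChain_cons] at h1
    have := ih ⟨h1.2, fun x hx => h2 x (by simp [hx])⟩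
    refine ⟨?_, ?_⟩
    · rw [List.map_cons, List.isChain_cons]
      refine ⟨?_, this.1⟩
      intro y hy
      cases l with
      | nil => simp at hy
      | cons w l =>
        simp at hy; subst hy
        exact (hbc _ (h2 _ (by simp)) _ (h2 _ (by simp))).trans (h1.1 w (by simp))
    · intro x hx
      simp only [List.mem_map] at hx
      obtain ⟨y, hy, rfl⟩ := hx
      exact hb _ (h2 _ hy)

lemma telescope (φ : ℕ → V → V) (c : Ch V) (hc : bd c = 0) (M : ℕ) :
    bd (∑ k ∈ Finset.range M, pr (φ k) (φ (k + 1)) c) = mp (φ 0) c + mp (φ M) c := by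
  induction M with
  | zero => simp [dbl]
  | succ M ih =>
    rw [Finset.sum_range_succ, map_add, ih, bd_pr, hc, map_zero, add_zero]
    have : ∀ A B C : Ch V, B + B = 0 → A + B + (B + C) = A + C := by
      intro A B C h
      rw [show A + B + (B + C) = A + C + (B + B) by abel, h, add_zero]
    exact this _ _ _ (dbl _)

/-- `s` is an odd sign function -/
def OddS [AddGroup V] (s : V → ZMod 2) : Prop := ∀ x, x ≠ 0 → s (-x) = s x + 1

lemma thL_neg [AddGroup V] (S : List (V → ZMod 2)) (hS : ∀ s ∈ S, OddS s) (l : List V)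
    (hl : ∀ x ∈ l, x ≠ 0) : thL S (l.map (fun x => -x)) = thL S l := by
  induction S generalizing l with
  | nil =>
    match l with
    | [] => rfl
    | [u] => rfl
    | u :: v :: l => rfl
  | cons s S ih =>
    match l with
    | [] => rfl
    | [u] => rfl
    | u :: v :: l =>
      have h1 := ih (fun s hs => hS s (by simp [hs])) (v :: l) (fun x hx => hl x (by simp at hx ⊢; tauto))
      simp only [List.map_cons, thL] at h1 ⊢
      rw [h1, hS s (by simp) u (hl u (by simp)), hS s (by simp) v (hl v (by simp))]
      linear_combination z2 1 * thL S (v :: l)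

lemma ps_neg [AddGroup V] [Dist V] {K : Set V} {η : ℝ} (hK : ∀ x ∈ K, x ≠ 0)
    (s) (S : List (V → ZMod 2)) (hs : OddS s) (hS : ∀ s ∈ S, OddS s)
    {c : Ch V} (hc : c ∈ sup (Gd K η)) :
    ps s S (mp (fun x => -x) c) = ps s S c + th S c := by
  have : c ∈ sup (Gd K η) → (ps s S ∘ₗ mp (fun x => -x)) c = (ps s S + th S) c := by
    refine sup_eq fun l hl => ?_
    simp only [LinearMap.comp_apply, LinearMap.add_apply, mp_gen, ps_gen, th_gen]
    have h1 := thL_neg S hS l (fun x hx => hK x (hl.2 x hx))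
    match l, hl, h1 with
    | [], _, _ => cases S <;> simp [psL, thL]
    | u :: l, hl, h1 =>
      simp only [List.map_cons, psL] at h1 ⊢
      rw [h1, hs u (hK u (hl.2 u (by simp)))]
      ring
  simpa using this hc

def KK (n i : ℕ) : Set (Fin (n + 1) → ℝ) := {x | ∑ j, |x j| = 1 ∧ ∀ j : Fin (n + 1), i < j.val → x j = 0}

lemma KK_ne {n i : ℕ} : ∀ x ∈ KK n i, x ≠ 0 := by
  rintro x ⟨h, _⟩ rfl
  simp at h

lemma KK_neg {n i : ℕ} : ∀ x ∈ KK n i, -x ∈ KK n i := by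
  rintro x ⟨h, h'⟩
  exact ⟨by simpa using h, fun j hj => by simp [h' j hj]⟩

lemma KK_norm {n i : ℕ} {x} (hx : x ∈ KK n i) : ‖x‖ ≤ 1 := by
  rw [pi_norm_le_iff_of_nonneg zero_le_one]
  intro j
  rw [← hx.1, Real.norm_eq_abs]
  exact Finset.single_le_sum (f := fun j => |x j|) (fun _ _ => abs_nonneg _) (Finset.mem_univ j)

def ph {n : ℕ} (e : Fin (n + 1) → ℝ) (t : ℝ) (x : Fin (n + 1) → ℝ) : Fin (n + 1) → ℝ :=
  (1 - t) • x + t • e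

lemma ph_mem {n i : ℕ} (hi : i + 1 < n + 1) {t : ℝ} (h0 : 0 ≤ t) (h1 : t ≤ 1) :
    ∀ x ∈ KK n i, ph (Pi.single ⟨i + 1, hi⟩ 1) t x ∈ KK n (i + 1) := by
  rintro x ⟨h, h'⟩
  refine ⟨?_, ?_⟩
  · have : ∀ j, |ph (Pi.single ⟨i + 1, hi⟩ 1) t x j| =
        (1 - t) * |x j| + t * (if j = ⟨i + 1, hi⟩ then 1 else 0) := by
      intro j
      by_cases hj : j = ⟨i + 1, hi⟩
      · subst hj
        have := h' ⟨i + 1, hi⟩ (by simp)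
        simp [ph, this, abs_of_nonneg h0]
      · simp [ph, hj, abs_mul, abs_of_nonneg (sub_nonneg.2 h1)]
    rw [Finset.sum_congr rfl (fun j _ => this j), Finset.sum_add_distrib, ← Finset.mul_sum,
      ← Finset.mul_sum, h]
    simp
  · intro j hj
    have hne : j ≠ ⟨i + 1, hi⟩ := by
      rintro rfl; simp at hj
    simp [ph, hne, h' j (by omega)]

lemma ph_dist {n : ℕ} (e : Fin (n + 1) → ℝ) {t : ℝ} (h0 : 0 ≤ t) (h1 : t ≤ 1) (x y) :
    dist (ph e t x) (ph e t y) ≤ dist x y := by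
  rw [ph, ph, dist_add_right, dist_smul₀]
  have : ‖1 - t‖ ≤ 1 := by rw [Real.norm_eq_abs, abs_le]; constructor <;> linarith
  exact mul_le_of_le_one_left dist_nonneg this

lemma ph_dist2 {n : ℕ} (e : Fin (n + 1) → ℝ) (he : ‖e‖ ≤ 1) (t t' : ℝ) (x) (hx : ‖x‖ ≤ 1) :
    dist (ph e t x) (ph e t' x) ≤ 2 * |t - t'| := by
  have : ph e t x - ph e t' x = (t - t') • (e - x) := by
    unfold ph; module
  rw [dist_eq_norm, this, norm_smul, Real.norm_eq_abs]
  have := norm_sub_le e x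
  nlinarith [abs_nonneg (t - t')]

lemma exists_chain (n N : ℕ) (hN : 0 < N) (i : ℕ) (hi : i ≤ n) :
    ∃ h ∈ sup (Gd (KK n i) (2 / N)), bd (h + mp (fun x => -x) h) = 0 ∧
      ∀ S : List ((Fin (n + 1) → ℝ) → ZMod 2), S.length = i → (∀ s ∈ S, OddS s) → th S h = 1 := by
  induction i with
  | zero =>
    refine ⟨gen [Pi.single 0 1], gen_mem ⟨by simp, ?_⟩, ?_, ?_⟩
    · intro x hx
      simp only [List.mem_singleton] at hx
      subst hx
      refine ⟨?_, ?_⟩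
      · rw [Finset.sum_eq_single 0]
        · simp
        · intro j _ hj; simp [hj]
        · simp
      · intro j hj
        have : j ≠ 0 := by rintro rfl; simp at hj
        simp [this]
    · simp [dbl]
    · intro S hS _
      rw [List.length_eq_zero_iff] at hS
      subst hS
      simp [thL]
  | succ i ih =>
    obtain ⟨h, hs, hb, hT⟩ := ih (by omega)
    have hi' : i + 1 < n + 1 := by omega
    set e : Fin (n + 1) → ℝ := Pi.single ⟨i + 1, hi'⟩ 1 with he
    have hen : ‖e‖ ≤ 1 := by
      rw [pi_norm_le_iff_of_nonneg zero_le_one]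
      intro j
      by_cases hj : j = ⟨i + 1, hi'⟩
      · subst hj; simp [he]
      · simp [he, hj]
    set φ : ℕ → (Fin (n + 1) → ℝ) → (Fin (n + 1) → ℝ) := fun k => ph e (k / N) with hφ
    set c := h + mp (fun x => -x) h with hc
    have hcs : c ∈ sup (Gd (KK n i) (2 / N)) :=
      Submodule.add_mem _ hs (mp_sup KK_neg (fun x _ y _ => by simp) hs)
    have hN' : (0 : ℝ) < N := by exact_mod_cast hN
    have hk : ∀ k : ℕ, k ≤ N → 0 ≤ (k / N : ℝ) ∧ (k / N : ℝ) ≤ 1 := by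
      intro k hk
      refine ⟨by positivity, ?_⟩
      rw [div_le_one hN']
      exact_mod_cast hk
    have hbd : bd (∑ k ∈ Finset.range N, pr (φ k) (φ (k + 1)) c) = c := by
      rw [telescope φ c hb N, mp_id' (a := φ 0) (by intro x; simp [hφ, ph])]
      have : mp (φ N) c = 0 := by
        rw [hc, map_add, mp_mp]
        have : φ N ∘ (fun x => -x) = φ N := by
          funext x; simp [hφ, ph, hN'.ne']
        rw [this, dbl]
      rw [this, add_zero]
    refine ⟨∑ k ∈ Finset.range N, pr (φ k) (φ (k + 1)) c, ?_, ?_, ?_⟩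
    · refine Submodule.sum_mem _ fun k hk' => ?_
      rw [Finset.mem_range] at hk'
      have a1 := hk k hk'.le
      have a2 := hk (k + 1) hk'
      refine pr_sup (ph_mem hi' a1.1 a1.2) (ph_mem hi' a2.1 a2.2)
        (fun x _ y _ => ph_dist e a1.1 a1.2 x y) (fun x _ y _ => ph_dist e a2.1 a2.2 x y) ?_ hcs
      intro x hx
      refine (ph_dist2 e hen _ _ x (KK_norm hx)).trans (le_of_eq ?_)
      have : (k / N : ℝ) - ((k + 1 : ℕ) / N : ℝ) = - (1 / N) := by
        push_cast; ring
      rw [this, abs_neg, abs_of_pos (by positivity)]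
      ring
    · rw [map_add, ← mp_bd, hbd, hc, map_add, mp_mp, mp_id' (a := (fun x => -x) ∘ fun x => -x) (by simp),
        add_comm (mp _ h), dbl]
    · intro S hS hodd
      match S, hS, hodd with
      | s :: S, hS, hodd =>
        rw [← ps_bd, hbd, hc, map_add,
          ps_neg KK_ne s S (hodd s (by simp)) (fun s hs => hodd s (by simp [hs])) hs,
          ← add_assoc, z2, zero_add]
        exact hT S (by simpa using hS) (fun s hs => hodd s (by simp [hs]))

lemma thL_ne {V : Type} [PseudoMetricSpace V] {K : Set V} {η : ℝ} (hη : 0 ≤ η) (S : List (V → ZMod 2)) (v : V) (l : List V)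
    (h : thL S (v :: l) ≠ 0) (hl : v :: l ∈ Gd K η) :
    ∀ s ∈ S, ∃ u ∈ K, ∃ w ∈ K, dist v u ≤ S.length * η ∧ dist v w ≤ S.length * η ∧ s u ≠ s w := by
  induction S generalizing v l with
  | nil => simp
  | cons s S ih =>
    match l with
    | [] => simp [thL] at h
    | w :: l =>
      simp only [thL] at h
      obtain ⟨hl1, hl2⟩ := hl
      rw [List.isChain_cons_cons] at hl1
      have h1 : s v + s w ≠ 0 := left_ne_zero_of_mul h
      have h2 := ih w l (right_ne_zero_of_mul h) ⟨hl1.2, fun x hx => hl2 x (by simp at hx ⊢; tauto)⟩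
      intro s' hs'
      rw [List.mem_cons] at hs'
      have hpos : 0 ≤ (S.length : ℝ) * η := by positivity
      rcases hs' with rfl | hs'
      · refine ⟨v, hl2 v (by simp), w, hl2 w (by simp), ?_, ?_, ?_⟩
        · rw [dist_self]; positivity
        · push_cast [List.length_cons]; linarith [hl1.1]
        · intro heq; rw [heq, z2] at h1; exact h1 rfl
      · obtain ⟨a, ha, b, hb, h3, h4, h5⟩ := h2 s' hs'
        refine ⟨a, ha, b, hb, ?_, ?_, h5⟩
        · push_cast [List.length_cons]; linarith [hl1.1, dist_triangle v w a]
        · push_cast [List.length_cons]; linarith [hl1.1, dist_triangle v w b]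

lemma odd_of_order {L : Type} [AddCommGroup L] [LinearOrder L] [IsOrderedAddMonoid L] :
    ∃ τ : L → ZMod 2, OddS τ := by
  classical
  refine ⟨fun x => if 0 < x then 1 else 0, ?_⟩
  intro x hx
  simp only [Left.neg_pos_iff]
  rcases lt_or_gt_of_ne hx with h | h
  · rw [if_pos h, if_neg h.le.not_gt, zero_add]
  · rw [if_neg (not_lt_of_gt h), if_pos h, z2]

lemma exists_odd (n : ℕ) (g : (Fin (n + 1) → ℝ) → ℝ) (hg : ∀ x, g (-x) = - g x) :
    ∃ s : (Fin (n + 1) → ℝ) → ZMod 2, OddS s ∧ ∀ x y, s x ≠ s y → g x * g y ≤ 0 := by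
  classical
  have htie : ∃ τ : (Fin (n + 1) → ℝ) → ZMod 2, OddS τ := by
    obtain ⟨τ, hτ⟩ := odd_of_order (L := Lex (Fin (n + 1) → ℝ))
    exact ⟨fun x => τ (toLex x), fun x hx => hτ (toLex x) (by simpa using hx)⟩
  obtain ⟨τ, hτ⟩ := htie
  refine ⟨fun x => if 0 < g x then 1 else if g x < 0 then 0 else τ x, ?_, ?_⟩
  · intro x hx
    simp only [hg, Left.neg_pos_iff, Left.neg_neg_iff]
    rcases lt_trichotomy (g x) 0 with h | h | h
    · simp [h, h.le.not_gt]
    · simp [h, hτ x hx]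
    · simp [h, h.le.not_gt, z2]
  · intro x y hxy
    by_contra hcon
    push Not at hcon
    apply hxy
    rcases pos_and_pos_or_neg_and_neg_of_mul_pos hcon with ⟨h1, h2⟩ | ⟨h1, h2⟩
    · simp [h1, h2]
    · simp [h1, h2, h1.le.not_gt, h2.le.not_gt]

lemma approx (n : ℕ) (g : (Fin (n + 1) → ℝ) → Fin n → ℝ) (hodd : ∀ x, g (-x) = - g x)
    (hcont : UniformContinuousOn g (KK n n)) (ε : ℝ) (hε : 0 < ε) :
    ∃ x ∈ KK n n, ‖g x‖ ≤ ε := by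
  rw [Metric.uniformContinuousOn_iff] at hcont
  obtain ⟨δ, hδ, hu⟩ := hcont (ε / 3) (by positivity)
  obtain ⟨N, hN⟩ := exists_nat_gt (2 * n / δ)
  have hN0 : (0 : ℝ) < N := lt_of_le_of_lt (by positivity) hN
  obtain ⟨h, hs, -, hT⟩ := exists_chain n N (by exact_mod_cast hN0) n le_rfl
  choose s hs1 hs2 using fun j : Fin n => exists_odd n (fun x => g x j) (fun x => by simp [hodd])
  have h1 := hT (List.ofFn s) (by simp) (by
    intro t ht
    rw [List.mem_ofFn] at ht
    obtain ⟨j, rfl⟩ := ht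
    exact hs1 j)
  have : ∃ l ∈ Gd (KK n n) (2 / N), thL (List.ofFn s) l ≠ 0 := by
    by_contra hcon
    push Not at hcon
    have : h ∈ sup (Gd (KK n n) (2 / N)) → th (List.ofFn s) h = (0 : Ch _ →ₗ[ZMod 2] ZMod 2) h :=
      sup_eq (by intro l hl; simpa using hcon l hl)
    rw [this hs] at h1
    simp at h1
  obtain ⟨l, hl, hne⟩ := this
  match l, hl, hne with
  | [], _, hne => 
    exfalso; apply hne
    cases List.ofFn s <;> rfl
  | v :: l, hl, hne =>
    have h3 := thL_ne (by positivity) _ v l hne hl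
    have hv : v ∈ KK n n := hl.2 v (by simp)
    refine ⟨v, hv, ?_⟩
    rw [pi_norm_le_iff_of_nonneg hε.le]
    intro j
    obtain ⟨u, hu1, w, hw1, hd1, hd2, hsj⟩ := h3 (s j) (by simp)
    have hmul := hs2 j u w hsj
    have hsmall : ((List.ofFn s).length : ℝ) * (2 / N) < δ := by
      rw [List.length_ofFn]
      rw [div_lt_iff₀ hδ] at hN
      rw [← mul_div_assoc, div_lt_iff₀ hN0]
      linarith
    have e1 := (dist_le_pi_dist _ _ j).trans_lt (hu v hv u hu1 (hd1.trans_lt hsmall))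
    have e2 := (dist_le_pi_dist _ _ j).trans_lt (hu v hv w hw1 (hd2.trans_lt hsmall))
    rw [Real.dist_eq, abs_lt] at e1 e2
    rw [Real.norm_eq_abs, abs_le]
    constructor
    · by_contra hc
      have : 0 < g u j * g w j := mul_pos_of_neg_of_neg (by linarith) (by linarith)
      linarith
    · by_contra hc
      have : 0 < g u j * g w j := mul_pos (by linarith) (by linarith)
      linarith

lemma KK_compact (n : ℕ) : IsCompact (KK n n) := by
  refine Metric.isCompact_of_isClosed_isBounded ?_ ?_
  · have : KK n n = {x | ∑ j, |x j| = 1} := by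
      ext x
      refine ⟨fun h => h.1, fun h => ⟨h, fun j hj => by omega⟩⟩
    rw [this]
    exact isClosed_eq (by fun_prop) continuous_const
  · exact (Metric.isBounded_closedBall (x := 0) (r := 1)).subset
      (fun x hx => by simpa using KK_norm hx)

theorem borsuk_ulam (n : ℕ) (G : (Fin (n + 1) → ℝ) → Fin n → ℝ) (hG : ContinuousOn G (KK n n)) :
    ∃ x ∈ KK n n, G x = G (-x) := by
  set g := fun x => G x - G (-x) with hg
  have hcont : ContinuousOn g (KK n n) :=
    hG.sub (hG.comp continuous_neg.continuousOn KK_neg)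
  have hodd : ∀ x, g (-x) = - g x := by intro x; simp [hg]
  have hap := approx n g hodd ((KK_compact n).uniformContinuousOn_of_continuous hcont)
  obtain ⟨x0, hx0, -⟩ := hap 1 one_pos
  obtain ⟨x, hx, hmin⟩ := (KK_compact n).exists_isMinOn ⟨x0, hx0⟩ hcont.norm
  refine ⟨x, hx, ?_⟩
  have : ‖g x‖ ≤ 0 := by
    refine le_of_forall_pos_le_add fun ε hε => ?_
    obtain ⟨y, hy, hyε⟩ := hap ε hε
    rw [zero_add]
    exact (hmin hy).trans hyε
  have := norm_le_zero_iff.1 this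
  exact sub_eq_zero.1 this

/-- the embedding of `ℝ^(d+1)` in `ℝ^(m+1)` at height `a` in the last coordinate -/
noncomputable def emb (m d : ℕ) (a : ℝ) (x : Fin (d + 1) → ℝ) : EuclideanSpace ℝ (Fin (m + 1)) :=
  WithLp.toLp 2 (fun j => if h : j.val < d + 1 then x ⟨j.val, h⟩ else if j.val = m then a else 0)

lemma emb_ne {m d : ℕ} (hmd : m > d) (a : ℝ) (x) (hx : x ≠ 0) : emb m d a x ≠ 0 := by
  intro h
  apply hx
  funext j
  have := congrArg (fun y : EuclideanSpace ℝ (Fin (m + 1)) => y ⟨j.val, by omega⟩) h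
  have hj : j.val ≤ d := by omega
  simpa [emb, hj] using this

lemma emb_cont (m d : ℕ) (a : ℝ) : Continuous (emb m d a) := by
  unfold emb
  refine (PiLp.continuous_toLp 2 _).comp (continuous_pi fun j => ?_)
  by_cases h : j.val < d + 1
  · simp only [h, dite_true]; fun_prop
  · simp only [h, dite_false]; fun_prop

lemma main_pair (m d : ℕ) (hmd : m > d)
    (f : Metric.sphere (0 : EuclideanSpace ℝ (Fin (m+1))) 1 → EuclideanSpace ℝ (Fin d))
    (hf : Continuous f) (a : ℝ) : ∃ x : Fin (d + 1) → ℝ, x ≠ 0 ∧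
    ∃ p q : Metric.sphere (0 : EuclideanSpace ℝ (Fin (m+1))) 1,
      (p : EuclideanSpace ℝ (Fin (m+1))) = ‖emb m d a x‖⁻¹ • emb m d a x ∧
      (q : EuclideanSpace ℝ (Fin (m+1))) = ‖emb m d a (-x)‖⁻¹ • emb m d a (-x) ∧ f p = f q := by
  classical
  have hmem : ∀ x, x ≠ 0 → ‖emb m d a x‖⁻¹ • emb m d a x ∈
      Metric.sphere (0 : EuclideanSpace ℝ (Fin (m+1))) 1 := by
    intro x hx
    have := norm_ne_zero_iff.2 (emb_ne hmd a x hx)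
    simp [norm_smul, this]
  let G : (Fin (d + 1) → ℝ) → Fin d → ℝ := fun x =>
    if hx : x ≠ 0 then (fun j => f ⟨_, hmem x hx⟩ j) else 0
  have hG : ContinuousOn G (KK d d) := by
    rw [continuousOn_iff_continuous_domRestrict]
    have : (KK d d).domRestrict G = fun x : KK d d => fun j => f ⟨_, hmem x.1 (KK_ne x.1 x.2)⟩ j := by
      funext x
      simp only [Set.domRestrict_apply, G]
      rw [dif_pos (KK_ne x.1 x.2)]
    rw [this]
    refine continuous_pi fun j => ?_
    refine (EuclideanSpace.proj (𝕜 := ℝ) j).continuous.comp (hf.comp ?_)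
    refine Continuous.subtype_mk ?_ _
    have hc : Continuous fun x : KK d d => emb m d a x := (emb_cont m d a).comp continuous_subtype_val
    exact (hc.norm.inv₀ (fun x => norm_ne_zero_iff.2 (emb_ne hmd a x (KK_ne x.1 x.2)))).smul hc
  obtain ⟨x, hx, hxx⟩ := borsuk_ulam d G hG
  have hx0 := KK_ne x hx
  have hx1 := KK_ne _ (KK_neg x hx)
  refine ⟨x, hx0, ⟨_, hmem x hx0⟩, ⟨_, hmem (-x) hx1⟩, rfl, rfl, ?_⟩
  simp only [G] at hxx
  rw [dif_pos hx0, dif_pos hx1] at hxx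
  ext j
  exact congrFun hxx j

lemma emb_neg (m d : ℕ) (x) : emb m d 0 (-x) = - emb m d 0 x := by
  ext j
  simp only [emb, PiLp.neg_apply]
  split_ifs <;> simp

lemma emb_last {m d : ℕ} (hmd : m > d) (a : ℝ) (x) : emb m d a x (Fin.last m) = a := by
  have : ¬ m ≤ d := by omega
  simp [emb, this]

end BU

theorem stmt_2 (m d : ℕ) (hmd : m > d)
    (f : Metric.sphere (0 : EuclideanSpace ℝ (Fin (m+1))) 1 → EuclideanSpace ℝ (Fin d))
    (hf : Continuous f) :
    (∃ p₀ : Metric.sphere (0 : EuclideanSpace ℝ (Fin (m+1))) 1, f p₀ = f (-p₀)) ∧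
    (∃ p₁ p₂ : Metric.sphere (0 : EuclideanSpace ℝ (Fin (m+1))) 1,
      p₁ ≠ p₂ ∧ p₁ ≠ -p₂ ∧ f p₁ = f p₂) := by
  constructor
  · obtain ⟨x, hx, p, q, hp, hq, hpq⟩ := BU.main_pair m d hmd f hf 0
    refine ⟨p, ?_⟩
    have : q = -p := by
      apply Subtype.ext
      rw [hq, BU.emb_neg]
      simp [hp]
    rw [← this, hpq]
  · obtain ⟨x, hx, p, q, hp, hq, hpq⟩ := BU.main_pair m d hmd f hf 1
    have n1 : 0 < ‖BU.emb m d 1 x‖⁻¹ := inv_pos.2 (norm_pos_iff.2 (BU.emb_ne hmd 1 x hx))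
    have n2 : 0 < ‖BU.emb m d 1 (-x)‖⁻¹ :=
      inv_pos.2 (norm_pos_iff.2 (BU.emb_ne hmd 1 (-x) (neg_ne_zero.2 hx)))
    have hpl : (p : EuclideanSpace ℝ (Fin (m+1))) (Fin.last m) = ‖BU.emb m d 1 x‖⁻¹ := by
      rw [hp, PiLp.smul_apply, BU.emb_last hmd]; simp
    have hql : (q : EuclideanSpace ℝ (Fin (m+1))) (Fin.last m) = ‖BU.emb m d 1 (-x)‖⁻¹ := by
      rw [hq, PiLp.smul_apply, BU.emb_last hmd]; simp
    refine ⟨p, q, ?_, ?_, hpq⟩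
    · rintro rfl
      rw [hpl] at hql
      rw [← hql, hp] at hq
      have h := smul_right_injective _ n1.ne' hq
      apply hx
      funext j
      have := congrArg (fun y : EuclideanSpace ℝ (Fin (m + 1)) => y ⟨j.val, by omega⟩) h
      have hj : j.val ≤ d := by omega
      simp [BU.emb, hj] at this
      simp only [Pi.zero_apply]
      linarith
    · intro h
      rw [h] at hpl
      have : ((-q : Metric.sphere (0 : EuclideanSpace ℝ (Fin (m+1))) 1) :
        EuclideanSpace ℝ (Fin (m+1))) (Fin.last m) = - (q : EuclideanSpace ℝ (Fin (m+1))) (Fin.last m) := rfl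
      rw [this, hql] at hpl
      linarith
end

section
/- Let f : S^m → ℝ^d be a continuous map with m ≥ d. Then there exists a point p ∈ S^m such that f(p) = f(-p). -/
theorem oddAlg_aux (A : Type) [CommRing A] [Algebra ℝ A] (N : ℕ) :
    ∀ (M : Type) [AddCommGroup M] [Module A M] [Module ℝ M] [IsScalarTower ℝ A M],
      Module.finrank ℝ M = N → Odd N → Nonempty (A →ₐ[ℝ] ℝ) := by
  induction N using Nat.strong_induction_on with
  | _ N ih =>
  intro M _ _ _ _ hN hodd
  have hpos : 0 < Module.finrank ℝ M := by rw [hN]; exact hodd.pos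
  have : Module.Finite ℝ M := Module.finite_of_finrank_pos hpos
  have : Nontrivial M := Module.nontrivial_of_finrank_pos hpos
  by_cases hs : IsSimpleModule A M
  · obtain ⟨I, hI, ⟨e⟩⟩ := isSimpleModule_iff_quot_maximal.mp hs
    let : Field (A ⧸ I) := Ideal.Quotient.field I
    have e' : M ≃ₗ[ℝ] (A ⧸ I) := e.restrictScalars ℝ
    have : Module.Finite ℝ (A ⧸ I) := Module.Finite.equiv e'
    have hfr : Module.finrank ℝ (A ⧸ I) = N := by rw [← e'.finrank_eq, hN]
    rcases Real.nonempty_algEquiv_or (A ⧸ I) with ⟨⟨e2⟩⟩ | ⟨⟨e2⟩⟩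
    · exact ⟨e2.toAlgHom.comp (Ideal.Quotient.mkₐ ℝ I)⟩
    · exfalso
      have := e2.toLinearEquiv.finrank_eq
      rw [hfr, Complex.finrank_real_complex] at this
      rw [this] at hodd
      exact absurd hodd (by decide)
  · have : ∃ K : Submodule A M, K ≠ ⊥ ∧ K ≠ ⊤ := by
      by_contra! hcon
      apply hs
      rw [isSimpleModule_iff]
      exact { eq_bot_or_eq_top := fun K => by
                by_cases h : K = ⊥
                · exact Or.inl h
                · exact Or.inr (hcon K h) }
    obtain ⟨K, hb, ht⟩ := this
    have hsum := Submodule.finrank_quotient_add_finrank (K.restrictScalars ℝ)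
    have hq : Module.finrank ℝ (M ⧸ K) = Module.finrank ℝ (M ⧸ (K.restrictScalars ℝ)) := rfl
    have hk : Module.finrank ℝ K = Module.finrank ℝ (K.restrictScalars ℝ) := rfl
    rw [← hq, ← hk, hN] at hsum
    have : Module.Finite ℝ K := inferInstanceAs (Module.Finite ℝ (K.restrictScalars ℝ))
    have : Module.Finite ℝ (M ⧸ K) := inferInstanceAs (Module.Finite ℝ (M ⧸ (K.restrictScalars ℝ)))
    have : Nontrivial K := (Submodule.nontrivial_iff_ne_bot).2 hb
    have : Nontrivial (M ⧸ K) := Submodule.Quotient.nontrivial_iff.2 ht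
    have h1 : 0 < Module.finrank ℝ K := Module.finrank_pos
    have h2 : 0 < Module.finrank ℝ (M ⧸ K) := Module.finrank_pos
    rcases Nat.even_or_odd (Module.finrank ℝ K) with he | ho
    · refine ih _ (by omega) (M ⧸ K) rfl ?_
      rw [← hsum] at hodd
      rcases Nat.even_or_odd (Module.finrank ℝ (M ⧸ K)) with h | h
      · exact absurd (h.add he) (Nat.not_even_iff_odd.2 hodd)
      · exact h
    · exact ih _ (by omega) K rfl ho

open MvPolynomial in
/-- Image of the monomial `x^m` when `x_i^d` is replaced by `g_i`. -/
noncomputable def phiMon {R : Type} [CommRing R] {n : ℕ} (d : ℕ)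
    (g : Fin n → MvPolynomial (Fin n) R) (m : Fin n →₀ ℕ) : MvPolynomial (Fin n) R :=
  ∏ i, (X i ^ (m i % d) * g i ^ (m i / d))

/-- The linear map replacing `x_i^d` by `g_i`. -/
noncomputable def phiMap {n : ℕ} (d : ℕ) (g : Fin n → MvPolynomial (Fin n) ℝ) :
    MvPolynomial (Fin n) ℝ →ₗ[ℝ] MvPolynomial (Fin n) ℝ :=
  (MvPolynomial.basisMonomials (Fin n) ℝ).constr ℝ (phiMon d g)

theorem phiMap_monomial {n : ℕ} (d : ℕ) (g : Fin n → MvPolynomial (Fin n) ℝ)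
    (m : Fin n →₀ ℕ) (c : ℝ) :
    phiMap d g (MvPolynomial.monomial m c) = c • phiMon d g m := by
  have h : MvPolynomial.monomial m c = c • MvPolynomial.basisMonomials (Fin n) ℝ m := by
    simp [MvPolynomial.smul_monomial]
  rw [h, map_smul, phiMap, Module.Basis.constr_basis]

theorem phiMon_add_single {R : Type} [CommRing R] {n : ℕ} (d : ℕ) (hd : 0 < d)
    (g : Fin n → MvPolynomial (Fin n) R) (m : Fin n →₀ ℕ) (i : Fin n) :
    phiMon d g (m + Finsupp.single i d) = g i * phiMon d g m := by
  unfold phiMon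
  rw [← Finset.mul_prod_erase _ _ (Finset.mem_univ i),
    ← Finset.mul_prod_erase (Finset.univ) (fun j => MvPolynomial.X j ^ (m j % d) * g j ^ (m j / d))
      (Finset.mem_univ i), ← mul_assoc]
  congr 1
  · simp only [Finsupp.add_apply, Finsupp.single_eq_same]
    rw [Nat.add_mod_right, Nat.add_div_right _ hd, pow_succ]
    ring
  · refine Finset.prod_congr rfl fun j hj => ?_
    have : j ≠ i := Finset.ne_of_mem_erase hj
    simp [this.symm]

theorem phiMap_X_pow_mul {n : ℕ} (d : ℕ) (hd : 0 < d) (g : Fin n → MvPolynomial (Fin n) ℝ)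
    (i : Fin n) (q : MvPolynomial (Fin n) ℝ) :
    phiMap d g (q * MvPolynomial.X i ^ d) = g i * phiMap d g q := by
  induction q using MvPolynomial.induction_on' with
  | monomial m c =>
    rw [MvPolynomial.X_pow_eq_monomial, MvPolynomial.monomial_mul, phiMap_monomial,
      phiMap_monomial, phiMon_add_single d hd, mul_one, mul_smul_comm]
  | add p q hp hq => rw [add_mul, map_add, hp, hq, map_add, mul_add]

theorem exists_common_zero {n : ℕ} (d : ℕ) (hd : Odd d) (g : Fin n → MvPolynomial (Fin n) ℝ)
    (hbij : Function.Bijective (phiMap d g)) :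
    ∃ z : Fin n → ℝ, ∀ i, MvPolynomial.eval z (g i) = 0 := by
  classical
  have hd0 : 0 < d := hd.pos
  let e := LinearEquiv.ofBijective (phiMap d g) hbij
  let small : (Fin n → Fin d) → (Fin n →₀ ℕ) := fun a => Finsupp.equivFunOnFinite.symm (fun i => (a i : ℕ))
  let r : MvPolynomial (Fin n) ℝ →ₗ[ℝ] ((Fin n → Fin d) → ℝ) :=
    LinearMap.pi fun a => MvPolynomial.lcoeff ℝ (small a)
  let L : MvPolynomial (Fin n) ℝ →ₗ[ℝ] ((Fin n → Fin d) → ℝ) := r ∘ₗ e.symm.toLinearMap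
  let I : Ideal (MvPolynomial (Fin n) ℝ) := Ideal.span (Set.range g)
  have hinj : Function.Injective small := by
    intro a b hab
    funext i
    have := DFunLike.congr_fun hab i
    exact Fin.ext (by simpa [small] using this)
  have hr : Function.Surjective r := by
    intro c
    refine ⟨∑ a, MvPolynomial.monomial (small a) (c a), ?_⟩
    funext b
    simp only [r, LinearMap.pi_apply, MvPolynomial.lcoeff_apply, MvPolynomial.coeff_sum,
      MvPolynomial.coeff_monomial, hinj.eq_iff]
    simp
  have hL : Function.Surjective L := hr.comp e.symm.surjective
  have hker : LinearMap.ker L = I.restrictScalars ℝ := by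
    apply le_antisymm
    · intro p hp
      obtain ⟨q, rfl⟩ := e.surjective p
      have hq : r q = 0 := by simpa [L] using hp
      change phiMap d g q ∈ I
      rw [q.as_sum, map_sum]
      refine Ideal.sum_mem _ fun m hm => ?_
      rw [phiMap_monomial, Algebra.smul_def]
      apply Ideal.mul_mem_left
      have : ∃ i, d ≤ m i := by
        by_contra! hcon
        have h1 := congrFun hq (fun i => ⟨m i, hcon i⟩)
        have h2 : small (fun i => ⟨m i, hcon i⟩) = m := by ext i; simp [small]
        simp only [r, LinearMap.pi_apply, MvPolynomial.lcoeff_apply, h2] at h1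
        exact (MvPolynomial.mem_support_iff.1 hm) h1
      obtain ⟨i, hi⟩ := this
      have hm' : m = (m - Finsupp.single i d) + Finsupp.single i d := by
        rw [tsub_add_cancel_of_le]
        simpa using hi
      rw [hm', phiMon_add_single d hd0]
      exact Ideal.mul_mem_right _ _ (Ideal.subset_span ⟨i, rfl⟩)
    · intro p hp
      have hp' : p ∈ I := hp
      have key : ∀ i q, L (q * g i) = 0 := by
        intro i q
        obtain ⟨q', rfl⟩ := e.surjective q
        have h1 : e q' * g i = e (q' * MvPolynomial.X i ^ d) := by
          change phiMap d g q' * g i = phiMap d g _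
          rw [phiMap_X_pow_mul d hd0, mul_comm]
        rw [h1]
        change r (e.symm (e _)) = 0
        rw [e.symm_apply_apply]
        funext a
        simp only [r, LinearMap.pi_apply, MvPolynomial.lcoeff_apply, Pi.zero_apply]
        rw [MvPolynomial.X_pow_eq_monomial, MvPolynomial.coeff_mul_monomial', if_neg]
        intro hle
        have := hle i
        have h2 := (a i).2
        simp [small] at this
        omega
      obtain ⟨c, rfl⟩ := (Ideal.mem_span_range_iff_exists_fun).1 hp'
      rw [LinearMap.mem_ker, map_sum]
      exact Finset.sum_eq_zero fun i _ => key i (c i)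
  have hfin : Module.finrank ℝ (MvPolynomial (Fin n) ℝ ⧸ I) = d ^ n := by
    have h1 := (L.quotKerEquivOfSurjective hL).finrank_eq
    rw [hker] at h1
    have h2 : Module.finrank ℝ (MvPolynomial (Fin n) ℝ ⧸ I)
      = Module.finrank ℝ (MvPolynomial (Fin n) ℝ ⧸ (I.restrictScalars ℝ)) := rfl
    rw [h2, h1]
    simp
  obtain ⟨φ⟩ := oddAlg_aux (MvPolynomial (Fin n) ℝ ⧸ I) (d ^ n) (MvPolynomial (Fin n) ℝ ⧸ I) hfin
    hd.pow
  let ψ := φ.comp (Ideal.Quotient.mkₐ ℝ I)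
  refine ⟨fun i => ψ (MvPolynomial.X i), fun i => ?_⟩
  have h : ψ (g i) = 0 := by
    have : Ideal.Quotient.mkₐ ℝ I (g i) = 0 :=
      Ideal.Quotient.eq_zero_iff_mem.2 (Ideal.subset_span ⟨i, rfl⟩)
    simp only [ψ, AlgHom.comp_apply, this, map_zero]
  have h2 : ψ = MvPolynomial.aeval (fun i => ψ (MvPolynomial.X i)) := by
    ext j; simp
  rw [h2] at h
  rw [← h, MvPolynomial.aeval_eq_eval]

theorem phiMon_totalDegree {n : ℕ} (d : ℕ) (g : Fin n → MvPolynomial (Fin n) ℝ)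
    (hg : ∀ i, (g i).totalDegree ≤ d) (m : Fin n →₀ ℕ) :
    (phiMon d g m).totalDegree ≤ m.degree := by
  unfold phiMon
  refine (MvPolynomial.totalDegree_finsetProd _ _).trans ?_
  rw [Finsupp.degree_eq_sum]
  refine Finset.sum_le_sum fun i _ => ?_
  refine (MvPolynomial.totalDegree_mul _ _).trans ?_
  have h1 := MvPolynomial.totalDegree_pow (MvPolynomial.X i : MvPolynomial (Fin n) ℝ) (m i % d)
  rw [MvPolynomial.totalDegree_X] at h1
  have h2 := MvPolynomial.totalDegree_pow (g i) (m i / d)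
  have h3 : m i / d * (g i).totalDegree ≤ m i / d * d := Nat.mul_le_mul_left _ (hg i)
  have h4 := Nat.mod_add_div' (m i) d
  omega

/-- Exponents of degree at most `k`. -/
@[ext]
structure SmallExp (n k : ℕ) : Type where
  val : Fin n →₀ ℕ
  prop : val.degree ≤ k

noncomputable instance (n k : ℕ) : DecidableEq (SmallExp n k) := Classical.decEq _

noncomputable instance (n k : ℕ) : Fintype (SmallExp n k) :=
  Fintype.ofInjective (fun (m : SmallExp n k) (i : Fin n) =>
      (⟨m.1 i, Nat.lt_succ_of_le ((Finsupp.le_degree i m.1).trans m.2)⟩ : Fin (k+1))) (by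
    intro a b hab
    apply SmallExp.ext
    ext i
    have := congrFun hab i
    simpa using this)

/-- Matrix of the truncated substitution map. -/
noncomputable def phiMat {R : Type} [CommRing R] {n : ℕ} (d k : ℕ)
    (g : Fin n → MvPolynomial (Fin n) R) : Matrix (SmallExp n k) (SmallExp n k) R :=
  Matrix.of fun m' m => MvPolynomial.coeff m'.1 (phiMon d g m.1)

theorem phiMap_sum_coeff {n : ℕ} (d k : ℕ) (g : Fin n → MvPolynomial (Fin n) ℝ)
    (c : SmallExp n k → ℝ) (m' : SmallExp n k) :
    MvPolynomial.coeff m'.1 (phiMap d g (∑ m, MvPolynomial.monomial m.1 (c m)))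
      = (phiMat d k g).mulVec c m' := by
  rw [map_sum, MvPolynomial.coeff_sum, Matrix.mulVec, dotProduct]
  refine Finset.sum_congr rfl fun m _ => ?_
  rw [phiMap_monomial, MvPolynomial.coeff_smul, phiMat, Matrix.of_apply, smul_eq_mul, mul_comm]

theorem phiMap_bijective {n : ℕ} (d : ℕ) (g : Fin n → MvPolynomial (Fin n) ℝ)
    (hg : ∀ i, (g i).totalDegree ≤ d) (hdet : ∀ k, (phiMat d k g).det ≠ 0) :
    Function.Bijective (phiMap d g) := by
  classical
  constructor
  · rw [← LinearMap.ker_eq_bot, LinearMap.ker_eq_bot']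
    intro p hp
    set k := p.totalDegree with hk
    have hps : p = ∑ m : SmallExp n k, MvPolynomial.monomial m.1 (MvPolynomial.coeff m.1 p) := by
      ext m
      rw [MvPolynomial.coeff_sum]
      simp only [MvPolynomial.coeff_monomial]
      by_cases hm : m.degree ≤ k
      · rw [Finset.sum_eq_single (⟨m, hm⟩ : SmallExp n k)]
        · simp
        · intro b _ hb
          rw [if_neg]
          intro h
          exact hb (SmallExp.ext h)
        · simp
      · rw [Finset.sum_eq_zero]
        · apply MvPolynomial.coeff_eq_zero_of_totalDegree_lt
          rw [← hk, ← Finsupp.degree_apply]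
          omega
        · intro b _
          rw [if_neg]
          rintro rfl
          exact hm b.2
    have hz : (phiMat d k g).mulVec (fun m => MvPolynomial.coeff m.1 p) = 0 := by
      funext m'
      rw [← phiMap_sum_coeff, ← hps, hp]
      simp
    have := Matrix.eq_zero_of_mulVec_eq_zero (hdet k) hz
    rw [hps]
    refine Finset.sum_eq_zero fun m _ => ?_
    rw [congrFun this m]
    simp
  · rw [← LinearMap.range_eq_top, eq_top_iff]
    intro p _
    rw [p.as_sum]
    refine Submodule.sum_mem _ fun m _ => ?_
    set k := m.degree
    let e : SmallExp n k → ℝ := fun m' => if m = m'.1 then MvPolynomial.coeff m p else 0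
    let c := (phiMat d k g)⁻¹.mulVec e
    have hc : (phiMat d k g).mulVec c = e := by
      rw [Matrix.mulVec_mulVec, Matrix.mul_nonsing_inv _ (isUnit_iff_ne_zero.2 (hdet k)),
        Matrix.one_mulVec]
    refine ⟨∑ m, MvPolynomial.monomial m.1 (c m), ?_⟩
    ext m'
    rw [MvPolynomial.coeff_monomial]
    by_cases hm : m'.degree ≤ k
    · rw [phiMap_sum_coeff d k g c ⟨m', hm⟩, hc]
    · rw [if_neg (by rintro rfl; exact hm le_rfl), map_sum, MvPolynomial.coeff_sum]
      refine Finset.sum_eq_zero fun b _ => ?_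
      rw [phiMap_monomial, MvPolynomial.coeff_smul,
        MvPolynomial.coeff_eq_zero_of_totalDegree_lt, smul_zero]
      rw [← Finsupp.degree_apply]
      have := phiMon_totalDegree d g hg b.1
      have := b.2
      omega

theorem phiMat_map {R S : Type} [CommRing R] [CommRing S] (φ : R →+* S) {n : ℕ} (d k : ℕ)
    (g : Fin n → MvPolynomial (Fin n) R) :
    φ.mapMatrix (phiMat d k g) = phiMat d k (fun i => MvPolynomial.map φ (g i)) := by
  ext m' m
  simp only [phiMat, RingHom.mapMatrix_apply, Matrix.map_apply, Matrix.of_apply]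
  rw [← MvPolynomial.coeff_map]
  congr 1
  simp [phiMon, map_prod]

theorem phiMat_X_pow {n : ℕ} (d k : ℕ) :
    phiMat d k (fun i : Fin n => (MvPolynomial.X i ^ d : MvPolynomial (Fin n) ℝ)) = 1 := by
  ext m' m
  have : phiMon d (fun i : Fin n => (MvPolynomial.X i ^ d : MvPolynomial (Fin n) ℝ)) m.1
      = MvPolynomial.monomial m.1 1 := by
    rw [phiMon, MvPolynomial.monomial_eq, Finsupp.prod_fintype _ _ (by simp)]
    simp only [map_one, one_mul]
    refine Finset.prod_congr rfl fun i _ => ?_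
    rw [← pow_mul, ← pow_add, Nat.mod_add_div]
  rw [phiMat, Matrix.of_apply, this, MvPolynomial.coeff_monomial, Matrix.one_apply]
  congr 1
  rw [eq_iff_iff]
  exact ⟨fun h => (SmallExp.ext h).symm, fun h => by rw [h]⟩

theorem exists_large_zero {n : ℕ} (d : ℕ) (hd : Odd d) (f : Fin n → MvPolynomial (Fin n) ℝ)
    (hf : ∀ i, (f i).totalDegree ≤ d) (T : ℝ) :
    ∃ s > T, ∃ z : Fin n → ℝ, ∀ i, z i ^ d + s * MvPolynomial.eval z (f i) = 0 := by
  classical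
  let G : Fin n → MvPolynomial (Fin n) (Polynomial ℝ) := fun i =>
    MvPolynomial.X i ^ d + MvPolynomial.C Polynomial.X * MvPolynomial.map Polynomial.C (f i)
  let g : ℝ → Fin n → MvPolynomial (Fin n) ℝ := fun s i =>
    MvPolynomial.X i ^ d + MvPolynomial.C s * (f i)
  have hGg : ∀ s i, MvPolynomial.map (Polynomial.evalRingHom s) (G i) = g s i := by
    intro s i
    have : (Polynomial.evalRingHom s).comp Polynomial.C = RingHom.id ℝ := by ext; simp
    simp [G, g, MvPolynomial.map_map, this, MvPolynomial.map_id]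
  let D : ℕ → Polynomial ℝ := fun k => (phiMat d k G).det
  have hD : ∀ k s, (D k).eval s = (phiMat d k (g s)).det := by
    intro k s
    change Polynomial.evalRingHom s (phiMat d k G).det = _
    rw [RingHom.map_det, phiMat_map]
    simp only [hGg]
  have hD0 : ∀ k, D k ≠ 0 := by
    intro k h
    have h1 := hD k 0
    have h2 : g 0 = fun i => MvPolynomial.X i ^ d := by funext i; simp [g]
    rw [h, h2, phiMat_X_pow] at h1
    simp at h1
  have hbad : (⋃ k, {s | (D k).eval s = 0}).Countable := by
    refine Set.countable_iUnion fun k => ?_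
    exact (Polynomial.finite_setOfPred_isRoot (hD0 k)).countable
  have : ∃ s ∈ Set.Ioi T, s ∉ (⋃ k, {s | (D k).eval s = 0}) := by
    by_contra! hcon
    have h1 : (Set.Ioi T).Countable := hbad.mono hcon
    exact absurd h1 (by
      rw [← Cardinal.le_aleph0_iff_set_countable, Cardinal.mk_Ioi_real, not_le]
      exact Cardinal.aleph0_lt_continuum)
  obtain ⟨s, hs, hs2⟩ := this
  refine ⟨s, hs, ?_⟩
  have hbij : Function.Bijective (phiMap d (g s)) := by
    apply phiMap_bijective
    · intro i
      refine (MvPolynomial.totalDegree_add _ _).trans (max_le ?_ ?_)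
      · rw [MvPolynomial.totalDegree_X_pow]
      · refine (MvPolynomial.totalDegree_mul _ _).trans ?_
        rw [MvPolynomial.totalDegree_C, zero_add]
        exact hf i
    · intro k hk
      apply hs2
      rw [Set.mem_iUnion]
      exact ⟨k, by rw [Set.mem_ofPred_eq, hD, hk]⟩
  obtain ⟨z, hz⟩ := exists_common_zero d hd (g s) hbij
  exact ⟨z, fun i => by simpa [g] using hz i⟩

theorem dehom_totalDegree {m D : ℕ} (F : MvPolynomial (Fin (m+1)) ℝ) (hF : F.totalDegree ≤ D) :
    (MvPolynomial.aeval (Fin.cons 1 MvPolynomial.X : Fin (m+1) → MvPolynomial (Fin m) ℝ)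
      F).totalDegree ≤ D := by
  rw [MvPolynomial.aeval_def, MvPolynomial.eval₂_eq']
  refine MvPolynomial.totalDegree_finsetSum_le fun a ha => ?_
  refine (MvPolynomial.totalDegree_mul _ _).trans ?_
  rw [MvPolynomial.algebraMap_eq, MvPolynomial.totalDegree_C, zero_add]
  refine (MvPolynomial.totalDegree_finsetProd _ _).trans ?_
  refine le_trans ?_ ((MvPolynomial.le_totalDegree ha).trans hF)
  rw [Finsupp.sum_fintype _ _ (by simp)]
  refine Finset.sum_le_sum fun i _ => ?_
  refine (MvPolynomial.totalDegree_pow _ _).trans ?_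
  have : ((Fin.cons 1 MvPolynomial.X : Fin (m+1) → MvPolynomial (Fin m) ℝ) i).totalDegree ≤ 1 := by
    refine Fin.cases ?_ (fun j => ?_) i
    · simp
    · simp
  nlinarith

theorem dehom_eval {m : ℕ} (F : MvPolynomial (Fin (m+1)) ℝ) (z : Fin m → ℝ) :
    MvPolynomial.eval z
      (MvPolynomial.aeval (Fin.cons 1 MvPolynomial.X : Fin (m+1) → MvPolynomial (Fin m) ℝ) F)
      = MvPolynomial.eval (Fin.cons 1 z : Fin (m+1) → ℝ) F := by
  induction F using MvPolynomial.induction_on with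
  | C a => simp
  | add p q hp hq => rw [map_add, map_add, map_add, hp, hq]
  | mul_X p i hp =>
    rw [map_mul, map_mul, map_mul, hp, MvPolynomial.aeval_X, MvPolynomial.eval_X]
    congr 1
    refine Fin.cases ?_ (fun j => ?_) i
    · simp
    · simp

theorem eval_smul_hom {σ : Type} [Fintype σ] {D : ℕ} (F : MvPolynomial σ ℝ)
    (hF : F.IsHomogeneous D) (r : ℝ) (x : σ → ℝ) :
    MvPolynomial.eval (r • x) F = r ^ D * MvPolynomial.eval x F := by
  rw [MvPolynomial.eval_eq', MvPolynomial.eval_eq', Finset.mul_sum]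
  refine Finset.sum_congr rfl fun a ha => ?_
  have h : ∑ i, a i = D := by
    have := hF (MvPolynomial.mem_support_iff.1 ha)
    rw [← this, Finsupp.weight_apply, Finsupp.sum_fintype _ _ (by simp)]
    simp
  simp only [Pi.smul_apply, smul_eq_mul, mul_pow, Finset.prod_mul_distrib]
  rw [Finset.prod_pow_eq_pow_sum, h]
  ring

theorem exists_homogenization {n D : ℕ} (hD : Odd D) (p : MvPolynomial (Fin n) ℝ)
    (hp : p.totalDegree ≤ D) :
    ∃ F : MvPolynomial (Fin n) ℝ, F.IsHomogeneous D ∧ ∀ x : Fin n → ℝ, ∑ i, x i ^ 2 = 1 →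
      MvPolynomial.eval x F = (MvPolynomial.eval x p - MvPolynomial.eval (-x) p) / 2 := by
  classical
  let Q : MvPolynomial (Fin n) ℝ := ∑ i, MvPolynomial.X i ^ 2
  have hQ : Q.IsHomogeneous 2 := by
    refine MvPolynomial.IsHomogeneous.sum _ _ _ fun i _ => ?_
    simpa using (MvPolynomial.isHomogeneous_X ℝ i).pow 2
  refine ⟨∑ j ∈ Finset.range (D+1), if Odd j then
    MvPolynomial.homogeneousComponent j p * Q ^ ((D - j)/2) else 0, ?_, ?_⟩
  · refine MvPolynomial.IsHomogeneous.sum _ _ _ fun j hj => ?_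
    split_ifs with ho
    · have h1 := (MvPolynomial.homogeneousComponent_isHomogeneous j p).mul (hQ.pow ((D-j)/2))
      convert h1 using 1
      have := Finset.mem_range.1 hj
      obtain ⟨a, rfl⟩ := hD
      obtain ⟨b, rfl⟩ := ho
      omega
    · exact MvPolynomial.isHomogeneous_zero _ _ _
  · intro x hx
    have hQx : MvPolynomial.eval x Q = 1 := by simpa [Q] using hx
    have hps : p = ∑ j ∈ Finset.range (D+1), MvPolynomial.homogeneousComponent j p := by
      conv_lhs => rw [← MvPolynomial.sum_homogeneousComponent p]
      refine Finset.sum_subset (Finset.range_mono (by omega)) fun j _ hj => ?_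
      apply MvPolynomial.homogeneousComponent_eq_zero
      simp at hj
      omega
    have e1 : MvPolynomial.eval x p
        = ∑ j ∈ Finset.range (D+1), MvPolynomial.eval x (MvPolynomial.homogeneousComponent j p) := by
      conv_lhs => rw [hps]
      rw [map_sum]
    have e2 : MvPolynomial.eval (-x) p = ∑ j ∈ Finset.range (D+1),
        (-1) ^ j * MvPolynomial.eval x (MvPolynomial.homogeneousComponent j p) := by
      conv_lhs => rw [hps]
      rw [map_sum]
      refine Finset.sum_congr rfl fun j _ => ?_
      rw [← eval_smul_hom _ (MvPolynomial.homogeneousComponent_isHomogeneous j p)]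
      simp
    rw [e1, e2, ← Finset.sum_sub_distrib, Finset.sum_div, map_sum]
    refine Finset.sum_congr rfl fun j _ => ?_
    split_ifs with ho
    · rw [map_mul, map_pow, hQx, one_pow, ho.neg_one_pow]
      ring
    · rw [(Nat.not_odd_iff_even.1 ho).neg_one_pow]
      simp

theorem exists_poly_approx {n : ℕ} (h : Metric.sphere (0 : EuclideanSpace ℝ (Fin n)) 1 → ℝ)
    (hc : Continuous h) (ε : ℝ) (hε : 0 < ε) :
    ∃ p : MvPolynomial (Fin n) ℝ, ∀ u : Metric.sphere (0 : EuclideanSpace ℝ (Fin n)) 1,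
      |MvPolynomial.eval (fun i => u.1 i) p - h u| < ε := by
  let S := Metric.sphere (0 : EuclideanSpace ℝ (Fin n)) 1
  let co : Fin n → C(S, ℝ) := fun i => ⟨fun u => u.1 i, by fun_prop⟩
  let Φ : MvPolynomial (Fin n) ℝ →ₐ[ℝ] C(S, ℝ) := MvPolynomial.aeval co
  have hsep : Φ.range.SeparatesPoints := by
    intro u v huv
    have : ∃ i, u.1 i ≠ v.1 i := by
      by_contra! hcon
      exact huv (Subtype.ext (by ext i; exact hcon i))
    obtain ⟨i, hi⟩ := this
    refine ⟨co i, ⟨co i, ⟨MvPolynomial.X i, by simp [Φ]⟩, rfl⟩, hi⟩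
  obtain ⟨⟨q, p, rfl⟩, hg⟩ :=
    ContinuousMap.exists_mem_subalgebra_near_continuous_of_separatesPoints Φ.range hsep h hc ε hε
  refine ⟨p, fun u => ?_⟩
  have key : Φ p u = MvPolynomial.eval (fun i => u.1 i) p := by
    have : (ContinuousMap.evalAlgHom ℝ ℝ u).comp Φ = MvPolynomial.aeval (fun i => u.1 i) := by
      ext i; simp [Φ, co]
    have := DFunLike.congr_fun this p
    simpa using this
  rw [← key]
  exact hg u

theorem approx_zero {m : ℕ}
    (h : Metric.sphere (0 : EuclideanSpace ℝ (Fin (m+1))) 1 → Fin m → ℝ) (hc : Continuous h)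
    (hodd : ∀ u, h (-u) = - h u) (ε : ℝ) (hε : 0 < ε) :
    ∃ u, ∀ i, |h u i| < ε := by
  choose p hp using fun i => exists_poly_approx (fun u => h u i) (by fun_prop) (ε/2) (by positivity)
  let D := 2 * (∑ i, (p i).totalDegree) + 1
  have hD : Odd D := odd_two_mul_add_one _
  have hpD : ∀ i, (p i).totalDegree ≤ D := by
    intro i
    have := Finset.single_le_sum (f := fun i => (p i).totalDegree) (fun _ _ => Nat.zero_le _)
      (Finset.mem_univ i)
    omega
  choose F hF1 hF2 using fun i => exists_homogenization hD (p i) (hpD i)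
  obtain ⟨s, hs, z, hz⟩ := exists_large_zero D hD (fun i =>
    MvPolynomial.aeval (Fin.cons 1 MvPolynomial.X : Fin (m+1) → MvPolynomial (Fin m) ℝ) (F i))
    (fun i => dehom_totalDegree _ (hF1 i).totalDegree_le) (2/ε)
  have hs0 : 0 < s := lt_trans (by positivity) hs
  let y : EuclideanSpace ℝ (Fin (m+1)) := WithLp.toLp 2 (Fin.cons 1 z)
  have hy : y ≠ 0 := by
    intro h0
    have := congrArg (fun v : EuclideanSpace ℝ (Fin (m+1)) => v 0) h0
    simp [y] at this
  have hr : 0 < ‖y‖ := norm_pos_iff.2 hy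
  let u : Metric.sphere (0 : EuclideanSpace ℝ (Fin (m+1))) 1 :=
    ⟨‖y‖⁻¹ • y, by simp [norm_smul, hr.ne']⟩
  have hu : ∑ i, (u.1 i) ^ 2 = 1 := by
    have h1 : ‖u.1‖ = 1 := by simpa using u.2
    have h2 := EuclideanSpace.real_norm_sq_eq u.1
    rw [h1] at h2
    simpa using h2.symm
  refine ⟨u, fun i => ?_⟩
  have hFu : MvPolynomial.eval (fun j => u.1 j) (F i) = - (u.1 i.succ) ^ D / s := by
    have h1 : (fun j => u.1 j) = ‖y‖⁻¹ • (Fin.cons 1 z : Fin (m+1) → ℝ) := by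
      funext j; simp [u, y]
    have h2 : u.1 i.succ = ‖y‖⁻¹ * z i := by simp [u, y]
    rw [h1, eval_smul_hom _ (hF1 i), ← dehom_eval, h2, mul_pow]
    have := hz i
    field_simp
    linarith
  have hle : |u.1 i.succ| ≤ 1 := by
    rw [← sq_le_one_iff_abs_le_one]
    refine le_trans ?_ hu.le
    exact Finset.single_le_sum (f := fun j => (u.1 j)^2) (fun _ _ => sq_nonneg _)
      (Finset.mem_univ i.succ)
  have hb : |MvPolynomial.eval (fun j => u.1 j) (F i)| < ε / 2 := by
    rw [hFu, abs_div, abs_neg, abs_pow, abs_of_pos hs0, div_lt_iff₀ hs0]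
    have h1 : |u.1 i.succ| ^ D ≤ 1 := pow_le_one₀ (abs_nonneg _) hle
    have h2 : 2 / ε < s := hs
    rw [div_lt_iff₀ hε] at h2
    linarith
  rw [hF2 i _ hu] at hb
  have a1 := hp i u
  have a2 := hp i (-u)
  have e1 : (fun j => (-u).1 j) = -(fun j => u.1 j) := by funext j; simp
  rw [hodd, e1] at a2
  simp only [Pi.neg_apply] at a2
  rw [abs_lt] at *
  constructor <;> linarith [a1.1, a1.2, a2.1, a2.2, hb.1, hb.2]

theorem stmt_4 (m d : ℕ) (hmd : d ≤ m)
    (f : Metric.sphere (0 : EuclideanSpace ℝ (Fin (m+1))) 1 → EuclideanSpace ℝ (Fin d))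
    (hf : Continuous f) :
    ∃ p : Metric.sphere (0 : EuclideanSpace ℝ (Fin (m+1))) 1, f p = f (-p) := by
  classical
  let h : Metric.sphere (0 : EuclideanSpace ℝ (Fin (m+1))) 1 → Fin m → ℝ := fun u i =>
    if hi : i.1 < d then f u ⟨i.1, hi⟩ - f (-u) ⟨i.1, hi⟩ else 0
  have hc : Continuous h := by
    refine continuous_pi fun i => ?_
    by_cases hi : i.1 < d
    · simp only [h, hi, dite_true]
      fun_prop
    · simp only [h, hi, dite_false]
      fun_prop
  have hodd : ∀ u, h (-u) = - h u := by
    intro u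
    funext i
    by_cases hi : i.1 < d <;> simp [h, hi]
  have hne : Nonempty (Metric.sphere (0 : EuclideanSpace ℝ (Fin (m+1))) 1) :=
    ⟨⟨EuclideanSpace.single 0 1, by simp⟩⟩
  obtain ⟨u, -, hu⟩ := isCompact_univ.exists_isMinOn Set.univ_nonempty hc.norm.continuousOn
  have hz : h u = 0 := by
    by_contra hne0
    obtain ⟨v, hv⟩ := approx_zero h hc hodd ‖h u‖ (norm_pos_iff.2 hne0)
    have h1 : ‖h u‖ ≤ ‖h v‖ := hu (Set.mem_univ v)
    have h2 : ‖h v‖ < ‖h u‖ := (pi_norm_lt_iff (norm_pos_iff.2 hne0)).2 hv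
    linarith
  refine ⟨u, ?_⟩
  ext i
  have := congrFun hz ⟨i.1, lt_of_lt_of_le i.2 hmd⟩
  simp only [h, i.2, dite_true, Pi.zero_apply] at this
  linarith
end

section
/- Let W₂ = {(p₁,p₂) ∈ S^m × S^m : p₁, p₂ linearly independent}, with ℤ/2 acting by swapping coordinates: τ·(p₁,p₂) = (p₂,p₁). If m > d, then there is no continuous ℤ/2-equivariant map from W₂ to S^(d-1), where ℤ/2 acts on S^(d-1) by the antipodal map. -/
namespace BU

abbrev R2 := ZMod 2

/-- mod 2 coboundary of a cochain on lists of points -/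
def D {X : Type} : List X → (List X → R2) → R2
  | [], _ => 0
  | x :: l, f => f l + D l (fun l' => f (x :: l'))

/-- dual prism operator between maps `h` and `h'` -/
def P {X : Type} (h h' : X → X) : List X → (List X → R2) → R2
  | [], _ => 0
  | x :: l, f => f (h x :: h' x :: l.map h') + P h h' l (fun l' => f (h x :: l'))

theorem two_zero (a : R2) : a + a = 0 := CharTwo.add_self_eq_zero a

theorem D_add {X : Type} (l : List X) : ∀ f g : List X → R2,
    D l (fun a => f a + g a) = D l f + D l g := by
  induction l with
  | nil => intro f g; simp [D]
  | cons x l ih => intro f g; simp only [D, ih]; ring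

theorem D_mul {X : Type} (l : List X) (c : R2) : ∀ f : List X → R2,
    D l (fun a => c * f a) = c * D l f := by
  induction l with
  | nil => intro f; simp [D]
  | cons x l ih => intro f; simp only [D, ih]; ring

theorem P_add {X : Type} (h h' : X → X) (l : List X) : ∀ f g : List X → R2,
    P h h' l (fun a => f a + g a) = P h h' l f + P h h' l g := by
  induction l with
  | nil => intro f g; simp [P]
  | cons x l ih => intro f g; simp only [P, ih]; ring

theorem D_D {X : Type} (l : List X) : ∀ f : List X → R2,
    D l (fun a => D a f) = 0 := by
  induction l with
  | nil => intro f; simp [D]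
  | cons x l ih =>
    intro f
    simp only [D, D_add, ih, add_zero, two_zero]

theorem D_map {X : Type} (t : X → X) (l : List X) : ∀ f : List X → R2,
    D (l.map t) f = D l (fun a => f (a.map t)) := by
  induction l with
  | nil => intro f; simp [D]
  | cons x l ih => intro f; simp only [D, List.map_cons, ih]

theorem P_D {X : Type} (h h' : X → X) (l : List X) : ∀ f : List X → R2,
    P h h' l (fun a => D a f) + D l (fun a => P h h' a f)
      = f (l.map h) + f (l.map h') := by
  induction l with
  | nil => intro f; simp [P, D, two_zero]
  | cons x l ih =>
    intro f
    have h1 := ih (fun a => f (h x :: a))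
    simp only [P, D, D_add, P_add, D_map, List.map_cons] at h1 ⊢
    have e1 := two_zero (P h h' l f)
    have e2 := two_zero (D l (fun a => f (h x :: h' x :: a.map h')))
    have e3 := two_zero (f (h x :: l.map h'))
    linear_combination h1 + e1 + e2 + e3

theorem P_congr {X : Type} (h h' : X → X) (l : List X) : ∀ f g : List X → R2,
    (∀ a : List X, (∀ x ∈ a, ∃ y ∈ l, x = h y ∨ x = h' y) → f a = g a) →
    P h h' l f = P h h' l g := by
  induction l with
  | nil => intro f g _; simp [P]
  | cons x l ih =>
    intro f g H
    simp only [P]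
    congr 1
    · apply H
      intro z hz
      simp only [List.mem_cons, List.mem_map] at hz
      rcases hz with rfl | rfl | ⟨y, hy, rfl⟩
      · exact ⟨x, by simp, Or.inl rfl⟩
      · exact ⟨x, by simp, Or.inr rfl⟩
      · exact ⟨y, by simp [hy], Or.inr rfl⟩
    · apply ih
      intro a ha
      apply H
      intro z hz
      rcases List.mem_cons.1 hz with rfl | hz
      · exact ⟨x, by simp, Or.inl rfl⟩
      · obtain ⟨y, hy, h⟩ := ha z hz
        exact ⟨y, by simp [hy], h⟩

/-- iterated cup product -/
def W {X : Type} (s : ℕ → X → R2) : ℕ → List X → R2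
  | 0, [_] => 1
  | k + 1, x :: y :: l => (s k x + s k y) * W s k (y :: l)
  | _, _ => 0

/-- multiply by the value of `s` at the first vertex -/
def M {X : Type} (s : X → R2) (f : List X → R2) : List X → R2
  | [] => 0
  | x :: l => s x * f (x :: l)

theorem W_nil {X : Type} (s : ℕ → X → R2) (k : ℕ) : W s k [] = 0 := by
  cases k <;> simp [W]

theorem D_M {X : Type} (s : ℕ → X → R2) (k : ℕ) (hk : ∀ l, D l (W s k) = 0) (l : List X) :
    D l (M (s k) (W s k)) = W s (k+1) l := by
  cases l with
  | nil => simp [D, W]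
  | cons x l =>
    have h1 := hk (x :: l)
    simp only [D, M, D_mul] at h1 ⊢
    cases l with
    | nil => simp [M, W, D]
    | cons y l =>
      simp only [M, W]
      have := two_zero (s k x * W s k (y :: l))
      linear_combination s k x * h1 - this

theorem D_W {X : Type} (s : ℕ → X → R2) (k : ℕ) : ∀ l, D l (W s k) = 0 := by
  induction k with
  | zero =>
    intro l
    match l with
    | [] => simp [D]
    | [x] => simp [D, W]
    | [x, y] => simp [D, W, two_zero]
    | x :: y :: z :: l =>
      have : ∀ (l : List X) , D l (fun _ => (0 : R2)) = 0 := by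
        intro l; induction l with
        | nil => rfl
        | cons x l ih => simp [D, ih]
      simp [D, W, this]
  | succ k ih =>
    intro l
    have : W s (k+1) = fun l => D l (M (s k) (W s k)) := by
      funext l; rw [D_M s k ih]
    rw [this, D_D]

theorem W_inv {X : Type} (s : ℕ → X → R2) (t : X → X) (k : ℕ) : ∀ l : List X,
    (∀ x ∈ l, ∀ i < k, s i (t x) = s i x + 1) → W s k (l.map t) = W s k l := by
  induction k with
  | zero =>
    intro l _
    match l with
    | [] => simp [W]
    | [x] => simp [W]
    | x :: y :: l => simp [W]
  | succ k ih =>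
    intro l hl
    match l with
    | [] => simp [W]
    | [x] => simp [W]
    | x :: y :: l =>
      have h1 := ih (y :: l) (fun z hz i hi => hl z (by simp at hz ⊢; tauto) i (by omega))
      simp only [List.map_cons, W] at h1 ⊢
      rw [h1, hl x (by simp) k (by omega), hl y (by simp) k (by omega)]
      have := two_zero (1 : R2)
      linear_combination (W s k (y :: l)) * this

theorem W_ne {X : Type} (s : ℕ → X → R2) (k : ℕ) : ∀ l : List X, W s k l ≠ 0 →
    l ≠ [] ∧ ∀ i < k, ∃ x ∈ l, ∃ y ∈ l, s i x ≠ s i y := by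
  induction k with
  | zero =>
    intro l hl
    refine ⟨?_, by simp⟩
    rintro rfl; simp [W] at hl
  | succ k ih =>
    intro l hl
    match l with
    | [] => simp [W] at hl
    | [x] => simp [W] at hl
    | x :: y :: l =>
      simp only [W] at hl
      refine ⟨by simp, fun i hi => ?_⟩
      rcases Nat.lt_succ_iff_lt_or_eq.1 hi with h | rfl
      · obtain ⟨a, ha, b, hb, hab⟩ := (ih _ (right_ne_zero_of_mul hl)).2 i h
        exact ⟨a, List.mem_cons_of_mem _ ha, b, List.mem_cons_of_mem _ hb, hab⟩
      · refine ⟨x, by simp, y, by simp, ?_⟩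
        intro h
        apply left_ne_zero_of_mul hl
        rw [h, two_zero]

/-! the chains -/

/-- basis vectors -/
def e (n k : ℕ) : Fin (n+1) → ℝ := fun i => if i.val = k then 1 else 0

/-- straight line homotopy to a vertex -/
noncomputable def H (n N k j : ℕ) (x : Fin (n+1) → ℝ) : Fin (n+1) → ℝ :=
  (1 - (j:ℝ)/N) • x + ((j:ℝ)/N) • e n k

noncomputable def C (n N : ℕ) : ℕ → (List (Fin (n+1) → ℝ) → R2) → R2
  | 0, f => f [e n 0]
  | k+1, f => ∑ j ∈ Finset.range N,
      (C n N k (fun l => P (H n N (k+1) j) (H n N (k+1) (j+1)) l f)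
      + C n N k (fun l => P (H n N (k+1) j) (H n N (k+1) (j+1)) (l.map (fun x => -x)) f))

theorem C_add (n N k : ℕ) : ∀ f g, C n N k (fun l => f l + g l) = C n N k f + C n N k g := by
  induction k with
  | zero => intro f g; simp [C]
  | succ k ih =>
    intro f g
    simp only [C, P_add, ih, ← Finset.sum_add_distrib]
    apply Finset.sum_congr rfl
    intros; ring

theorem C_D (n N : ℕ) (hN : 0 < N) (k : ℕ) : ∀ f, C n N (k+1) (fun l => D l f)
    = C n N k f + C n N k (fun l => f (l.map (fun x => -x))) := by
  have key : ∀ k, (∀ f, C n N k (fun l => D l f) + C n N k (fun l => D (l.map (fun x => -x)) f) = 0)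
     → ∀ f, C n N (k+1) (fun l => D l f)
    = C n N k f + C n N k (fun l => f (l.map (fun x => -x))) := by
    intro k hk f
    set z : (List (Fin (n+1) → ℝ) → R2) → R2 := fun f =>
      C n N k f + C n N k (fun l => f (l.map (fun x => -x))) with hz
    have step : ∀ j, C n N k (fun l => P (H n N (k+1) j) (H n N (k+1) (j+1)) l (fun l => D l f))
      + C n N k (fun l => P (H n N (k+1) j) (H n N (k+1) (j+1)) (l.map (fun x => -x)) (fun l => D l f))
      = z (fun l => f (l.map (H n N (k+1) j))) + z (fun l => f (l.map (H n N (k+1) (j+1)))) := by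
      intro j
      have h1 := hk (fun a => P (H n N (k+1) j) (H n N (k+1) (j+1)) a f)
      have e1 : ∀ l : List (Fin (n+1) → ℝ), f (l.map (H n N (k+1) j)) + f (l.map (H n N (k+1) (j+1))) = _ :=
        fun l => (P_D (H n N (k+1) j) (H n N (k+1) (j+1)) l f).symm
      have hzadd : ∀ f g, z (fun l => f l + g l) = z f + z g := by
        intro f g; simp only [hz, C_add]; ring
      rw [← hzadd]
      simp only [e1, hzadd]
      simp only [hz]
      linear_combination - h1
    have tot : ∀ m, ∑ j ∈ Finset.range m, (z (fun l => f (l.map (H n N (k+1) j)))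
        + z (fun l => f (l.map (H n N (k+1) (j+1)))))
        = z (fun l => f (l.map (H n N (k+1) 0))) + z (fun l => f (l.map (H n N (k+1) m))) := by
      intro m
      induction m with
      | zero => simp [two_zero]
      | succ m ih =>
        rw [Finset.sum_range_succ, ih]
        have := two_zero (z (fun l => f (l.map (H n N (k+1) m))))
        linear_combination this
    simp only [C, step]
    rw [tot]
    have h0 : H n N (k+1) 0 = id := by
      funext x; simp [H]
    have h1 : ∀ x, H n N (k+1) N x = e n (k+1) := by
      intro x
      have : (N:ℝ) ≠ 0 := by positivity
      simp [H, div_self this]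
    have h2 : z (fun l => f (l.map (H n N (k+1) N))) = 0 := by
      simp only [hz, List.map_map]
      have : (H n N (k+1) N ∘ fun x => -x) = H n N (k+1) N := by
        funext x; simp [h1]
      rw [this, two_zero]
    rw [h2, h0]
    simp [hz]
  induction k with
  | zero =>
    apply key
    intro f
    simp [C, D, two_zero]
  | succ k ih =>
    apply key
    intro f
    simp only [D_map]
    rw [ih, ih]
    have : ∀ l : List (Fin (n+1) → ℝ), List.map (fun x => -x) (List.map (fun x => -x) l) = l := by
      intro l; simp
    simp only [this]
    linear_combination two_zero (C n N k f) + two_zero (C n N k (fun l => f (List.map (fun x => -x) l)))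

/-- points of the `ℓ¹`-sphere supported on the first `k+1` coordinates -/
def GoodPt (n k : ℕ) (x : Fin (n+1) → ℝ) : Prop :=
  ∑ i, |x i| = 1 ∧ ∀ i : Fin (n+1), k < i.val → x i = 0

def Good (n N k : ℕ) (l : List (Fin (n+1) → ℝ)) : Prop :=
  (∀ x ∈ l, GoodPt n k x) ∧ ∀ x ∈ l, ∀ y ∈ l, dist x y ≤ 2 * k / N

theorem GoodPt.norm_le {n k : ℕ} {x : Fin (n+1) → ℝ} (h : GoodPt n k x) : ‖x‖ ≤ 1 := by
  rw [pi_norm_le_iff_of_nonneg zero_le_one]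
  intro i
  rw [Real.norm_eq_abs, ← h.1]
  exact Finset.single_le_sum (f := fun i => |x i|) (fun i _ => abs_nonneg _) (Finset.mem_univ i)

theorem GoodPt.neg {n k : ℕ} {x : Fin (n+1) → ℝ} (h : GoodPt n k x) : GoodPt n k (-x) := by
  refine ⟨by simpa using h.1, fun i hi => by simp [h.2 i hi]⟩

theorem GoodPt.ne {n k : ℕ} {x : Fin (n+1) → ℝ} (h : GoodPt n k x) : x ≠ 0 := by
  rintro rfl
  have := h.1
  simp at this

theorem goodPt_e (n k : ℕ) (hk : k ≤ n) : GoodPt n k (e n k) := by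
  constructor
  · rw [Finset.sum_eq_single (⟨k, by omega⟩ : Fin (n+1))]
    · simp [e]
    · intro b _ hb
      have : b.val ≠ k := fun h => hb (Fin.ext h)
      simp [e, this]
    · simp
  · intro i hi
    have : i.val ≠ k := by omega
    simp [e, this]

theorem GoodPt.H {n k N j : ℕ} {x : Fin (n+1) → ℝ} (h : GoodPt n k x) (hk : k + 1 ≤ n)
    (hj : j ≤ N) (hN : 0 < N) : GoodPt n (k+1) (H n N (k+1) j x) := by
  have hN' : (0:ℝ) < N := by positivity
  have t0 : 0 ≤ (j:ℝ)/N := by positivity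
  have t1 : (j:ℝ)/N ≤ 1 := by
    rw [div_le_one hN']; exact_mod_cast hj
  have he := goodPt_e n (k+1) hk
  constructor
  · have : ∀ i, |BU.H n N (k+1) j x i| = (1 - (j:ℝ)/N) * |x i| + ((j:ℝ)/N) * |e n (k+1) i| := by
      intro i
      simp only [BU.H, Pi.add_apply, Pi.smul_apply, smul_eq_mul]
      by_cases hi : i.val = k+1
      · rw [h.2 i (by omega)]
        simp [abs_mul, abs_of_nonneg t0]
      · simp [e, hi, abs_mul, abs_of_nonneg (sub_nonneg.2 t1)]
    simp only [this, Finset.sum_add_distrib, ← Finset.mul_sum, h.1, he.1]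
    ring
  · intro i hi
    simp [BU.H, h.2 i (by omega), he.2 i hi]

theorem dist_HH {n k N i j : ℕ} {x y : Fin (n+1) → ℝ} (hx : GoodPt n k x)
    (hk : k + 1 ≤ n) (hN : 0 < N) (hi : i ≤ N)
    (hij : i = j ∨ i = j + 1 ∨ j = i + 1) (hj : j ≤ N) :
    dist (H n N (k+1) i x) (H n N (k+1) j y) ≤ dist x y + 2 / N := by
  have hN' : (0:ℝ) < N := by positivity
  have t0 : 0 ≤ (j:ℝ)/N := by positivity
  have t1 : (j:ℝ)/N ≤ 1 := by
    rw [div_le_one hN']; exact_mod_cast hj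
  have he := (goodPt_e n (k+1) hk).norm_le
  have hx' := hx.norm_le
  have hd : |(i:ℝ)/N - (j:ℝ)/N| ≤ 1 / N := by
    rw [← sub_div, abs_div, abs_of_pos hN']
    gcongr
    rcases hij with h | h | h <;> rw [h] <;> simp
  have key : H n N (k+1) i x - H n N (k+1) j y
      = (1 - (j:ℝ)/N) • (x - y) + ((i:ℝ)/N - (j:ℝ)/N) • (e n (k+1) - x) := by
    simp only [H]; module
  rw [dist_eq_norm, dist_eq_norm, key]
  refine (norm_add_le _ _).trans ?_
  rw [norm_smul, norm_smul, Real.norm_eq_abs, Real.norm_eq_abs, abs_of_nonneg (sub_nonneg.2 t1)]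
  have h3 : ‖e n (k+1) - x‖ ≤ 2 := (norm_sub_le _ _).trans (by linarith)
  have h4 : |(i:ℝ)/N - (j:ℝ)/N| * ‖e n (k+1) - x‖ ≤ (1/N) * 2 := by gcongr
  have h5 : (1 - (j:ℝ)/N) * ‖x - y‖ ≤ ‖x - y‖ := by
    nlinarith [norm_nonneg (x-y)]
  have : (1/(N:ℝ)) * 2 = 2 / N := by ring
  linarith

theorem C_congr (n N : ℕ) (hN : 0 < N) (k : ℕ) : k ≤ n → ∀ f g,
    (∀ l, Good n N k l → f l = g l) → C n N k f = C n N k g := by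
  induction k with
  | zero =>
    intro _ f g h
    simp only [C]
    apply h
    refine ⟨?_, ?_⟩
    · intro x hx
      simp only [List.mem_singleton] at hx
      subst hx
      exact goodPt_e n 0 (by omega)
    · intro x hx y hy
      simp only [List.mem_singleton] at hx hy
      subst hx; subst hy
      simp
  | succ k ih =>
    intro hk f g h
    have main : ∀ j < N, ∀ l, Good n N k l → P (H n N (k+1) j) (H n N (k+1) (j+1)) l f
        = P (H n N (k+1) j) (H n N (k+1) (j+1)) l g := by
      intro j hj l hl
      apply P_congr
      intro a ha
      apply h
      have ha' : ∀ x ∈ a, ∃ y ∈ l, ∃ i, (i = j ∨ i = j + 1) ∧ x = H n N (k+1) i y := by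
        intro x hx
        obtain ⟨y, hy, h | h⟩ := ha x hx
        · exact ⟨y, hy, j, Or.inl rfl, h⟩
        · exact ⟨y, hy, j+1, Or.inr rfl, h⟩
      refine ⟨?_, ?_⟩
      · intro x hx
        obtain ⟨y, hy, i, hi, rfl⟩ := ha' x hx
        exact (hl.1 y hy).H hk (by omega) hN
      · intro x hx x' hx'
        obtain ⟨y, hy, i, hi, rfl⟩ := ha' x hx
        obtain ⟨y', hy', i', hi', rfl⟩ := ha' x' hx'
        have h1 := dist_HH (y := y') (hl.1 y hy) hk hN (i := i) (j := i') (by omega) (by omega)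
          (by omega)
        have h2 := hl.2 y hy y' hy'
        have : 2 * ((k+1 : ℕ) : ℝ) / N = 2 * k / N + 2 / N := by push_cast; ring
        rw [this]; linarith
    have hneg : ∀ l, Good n N k l → Good n N k (l.map (fun x => -x)) := by
      intro l hl
      refine ⟨?_, ?_⟩
      · intro x hx
        obtain ⟨y, hy, rfl⟩ := List.mem_map.1 hx
        exact (hl.1 y hy).neg
      · intro x hx x' hx'
        obtain ⟨y, hy, rfl⟩ := List.mem_map.1 hx
        obtain ⟨y', hy', rfl⟩ := List.mem_map.1 hx'
        rw [dist_neg_neg]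
        exact hl.2 y hy y' hy'
    simp only [C]
    apply Finset.sum_congr rfl
    intro j hj
    have hj := Finset.mem_range.1 hj
    congr 1
    · exact ih (by omega) _ _ (fun l hl => main j hj l hl)
    · exact ih (by omega) _ _ (fun l hl => main j hj _ (hneg l hl))

theorem C_W (n N : ℕ) (hN : 0 < N) (s : ℕ → (Fin (n+1) → ℝ) → R2)
    (hs : ∀ i < n, ∀ x ≠ 0, s i (-x) = s i x + 1) (k : ℕ) : k ≤ n → C n N k (W s k) = 1 := by
  induction k with
  | zero => intro _; simp [C, W]
  | succ k ih =>
    intro hk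
    have h0 : W s (k+1) = fun l => D l (M (s k) (W s k)) := by
      funext l; rw [D_M s k (D_W s k)]
    rw [h0, C_D n N hN, ← C_add, ← ih (by omega)]
    apply C_congr n N hN k (by omega)
    intro l hl
    have h1 := W_inv s (fun x => -x) k l (fun x hx i hi => hs i (by omega) x (hl.1 x hx).ne)
    cases l with
    | nil => simp [M, W_nil]
    | cons x l =>
      simp only [List.map_cons, M] at h1 ⊢
      rw [h1, hs k (by omega) x (hl.1 x (by simp)).ne]
      linear_combination two_zero (s k x * W s k (x :: l))

theorem C_zero (n N k : ℕ) : C n N k (fun _ => 0) = 0 := by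
  have := C_add n N k (fun _ => 0) (fun _ => 0)
  simpa using this

theorem exists_small (n N : ℕ) (hN : 0 < N) (s : ℕ → (Fin (n+1) → ℝ) → R2)
    (hs : ∀ i < n, ∀ x ≠ 0, s i (-x) = s i x + 1) :
    ∃ l, Good n N n l ∧ W s n l ≠ 0 := by
  by_contra! hcon
  have h1 := C_W n N hN s hs n le_rfl
  rw [C_congr n N hN n le_rfl _ (fun _ => 0) hcon, C_zero] at h1
  exact absurd h1 (by decide)

open Classical in
theorem borsuk_ulam_s10 (n : ℕ) (F : (Fin (n+1) → ℝ) → (Fin n → ℝ))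
    (hF : ContinuousOn F {x | x ≠ 0}) (hodd : ∀ x ≠ 0, F (-x) = - F x) :
    ∃ x ≠ 0, F x = 0 := by
  by_contra! hne
  set K : Set (Fin (n+1) → ℝ) := {x | ∑ i, |x i| = 1} with hK
  have good : ∀ x ∈ K, GoodPt n n x := fun x hx => ⟨hx, fun i hi => by omega⟩
  have hKc : IsCompact K := by
    apply Metric.isCompact_of_isClosed_isBounded
    · exact isClosed_eq (by fun_prop) continuous_const
    · apply (Metric.isBounded_closedBall (x := (0 : Fin (n+1) → ℝ)) (r := 1)).subset
      intro x hx
      simpa using (good x hx).norm_le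
  have hFK : ContinuousOn F K := hF.mono (fun x hx => (good x hx).ne)
  have hKne : K.Nonempty := ⟨e n n, (goodPt_e n n le_rfl).1⟩
  obtain ⟨x₀, hx₀, hmin⟩ := hKc.exists_isMinOn hKne hFK.norm
  set μ := ‖F x₀‖ with hμ
  have hμ0 : 0 < μ := norm_pos_iff.2 (hne _ (good x₀ hx₀).ne)
  have huc := hKc.uniformContinuousOn_of_continuous hFK
  rw [Metric.uniformContinuousOn_iff] at huc
  obtain ⟨δ, hδ, huc⟩ := huc (μ/2) (by positivity)
  obtain ⟨N, hN⟩ := exists_nat_gt (2 * n / δ)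
  have hN0' : (0:ℝ) < N := lt_of_le_of_lt (by positivity) hN
  have hN0 : 0 < N := by exact_mod_cast hN0'
  have hsm : 2 * (n:ℝ) / N < δ := by
    rw [div_lt_iff₀ hδ] at hN
    rw [div_lt_iff₀ hN0']; linarith
  let s : ℕ → (Fin (n+1) → ℝ) → R2 := fun i x =>
    if h : i < n then
      if 0 < F x ⟨i, h⟩ ∨ (F x ⟨i, h⟩ = 0 ∧ WellOrderingRel x (-x)) then 1 else 0
    else 0
  have hs : ∀ i < n, ∀ x ≠ 0, s i (-x) = s i x + 1 := by
    intro i hi x hx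
    simp only [s, hi, dif_pos, hodd x hx, Pi.neg_apply, neg_neg]
    have e1 : (1 : R2) + 1 = 0 := by decide
    rcases lt_trichotomy (F x ⟨i, hi⟩) 0 with h | h | h
    · simp [h, h.ne, not_lt.2 h.le]
    · have hxx : x ≠ -x := fun h => hx (by
        have h2 := self_eq_neg.1 h
        exact h2)
      simp only [h, neg_zero, lt_irrefl, false_or, true_and]
      rcases trichotomous_of WellOrderingRel x (-x) with h' | h' | h'
      · have := asymm_of WellOrderingRel h'
        simp [h', this, e1]
      · exact absurd h' hxx
      · have := asymm_of WellOrderingRel h'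
        simp [h', this]
    · simp [h, h.ne', not_lt.2 h.le, e1]
  obtain ⟨l, hl, hW⟩ := exists_small n N hN0 s hs
  obtain ⟨hl0, hch⟩ := W_ne s n l hW
  have hmem : ∀ x ∈ l, x ∈ K := fun x hx => (hl.1 x hx).1
  obtain ⟨p, hp⟩ := List.exists_mem_of_ne_nil l hl0
  have hclose : ∀ x ∈ l, ∀ y ∈ l, ∀ i, |F x i - F y i| < μ/2 := by
    intro x hx y hy i
    have := huc x (hmem x hx) y (hmem y hy) ((hl.2 x hx y hy).trans_lt hsm)
    exact (dist_le_pi_dist (F x) (F y) i).trans_lt this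
  have : ‖F p‖ < μ := by
    rw [pi_norm_lt_iff hμ0]
    rintro ⟨i, hi⟩
    obtain ⟨x, hx, y, hy, hxy⟩ := hch i hi
    have hsgn : F x ⟨i, hi⟩ * F y ⟨i, hi⟩ ≤ 0 := by
      by_contra! hpos
      apply hxy
      simp only [s, hi, dif_pos]
      rcases pos_and_pos_or_neg_and_neg_of_mul_pos hpos with ⟨h1, h2⟩ | ⟨h1, h2⟩
      · simp [h1, h2]
      · simp [not_lt.2 h1.le, not_lt.2 h2.le, h1.ne, h2.ne]
    have h1 := abs_lt.1 (hclose x hx y hy ⟨i, hi⟩)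
    have h2 := abs_lt.1 (hclose p hp x hx ⟨i, hi⟩)
    have h3 := abs_lt.1 (hclose p hp y hy ⟨i, hi⟩)
    rw [Real.norm_eq_abs, abs_lt]
    rcases mul_nonpos_iff.1 hsgn with ⟨a, b⟩ | ⟨a, b⟩ <;> constructor <;> linarith
  exact absurd (hmin (hmem p hp)) (not_le.2 this)

/-- `e + v(y)`, with `v` embedding the first `d+1` coordinates -/
def q (m d : ℕ) (y : Fin (d+1) → ℝ) : EuclideanSpace ℝ (Fin (m+1)) :=
  WithLp.toLp 2 (fun i => if h : i.val < d+1 then y ⟨i.val, h⟩ else if i.val = m then 1 else 0)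

theorem q_cont (m d : ℕ) : Continuous (q m d) := by
  unfold q
  apply (PiLp.continuous_toLp 2 _).comp
  apply continuous_pi
  intro i
  split_ifs <;> fun_prop

theorem q_last (m d : ℕ) (h : d < m) (y) : q m d y (Fin.last m) = 1 := by
  have h' : ¬ m < d + 1 := by omega
  simp only [q, Fin.val_last, if_true]
  exact dif_neg h'

theorem q_ne (m d : ℕ) (h : d < m) (y) : q m d y ≠ 0 := by
  intro h0
  have := q_last m d h y
  rw [h0] at this
  simp at this

theorem q_coord (m d : ℕ) (h : d < m) (y : Fin (d+1) → ℝ) (i : Fin (d+1)) :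
    q m d y ⟨i.val, by omega⟩ = y i := by
  have h' : i.val < d + 1 := i.2
  simp only [q, dif_pos h']

theorem q_indep (m d : ℕ) (h : d < m) (y : Fin (d+1) → ℝ) (hy : y ≠ 0) (a b : ℝ)
    (hab : a • q m d y + b • q m d (-y) = 0) : a = 0 ∧ b = 0 := by
  obtain ⟨i, hi⟩ := Function.ne_iff.1 hy
  have h1 := congrArg (fun v : EuclideanSpace ℝ (Fin (m+1)) => v (Fin.last m)) hab
  have h2 := congrArg (fun v : EuclideanSpace ℝ (Fin (m+1)) => v ⟨i.val, by omega⟩) hab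
  simp only [PiLp.add_apply, PiLp.smul_apply, smul_eq_mul, q_last m d h, q_coord m d h,
    PiLp.zero_apply, Pi.neg_apply] at h1 h2
  have h3 : (a - b) * y i = 0 := by linear_combination h2
  have h4 : a - b = 0 := by
    rcases mul_eq_zero.1 h3 with h | h
    · exact h
    · exact absurd h hi
  constructor <;> linarith

noncomputable def u (m d : ℕ) (y : Fin (d+1) → ℝ) : EuclideanSpace ℝ (Fin (m+1)) :=
  (‖q m d y‖)⁻¹ • q m d y

theorem u_norm (m d : ℕ) (h : d < m) (y) : ‖u m d y‖ = 1 := by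
  have := norm_ne_zero_iff.2 (q_ne m d h y)
  simp [u, norm_smul, this]

theorem u_cont (m d : ℕ) (h : d < m) : Continuous (u m d) := by
  unfold u
  exact ((q_cont m d).norm.inv₀ (fun y => norm_ne_zero_iff.2 (q_ne m d h y))).smul (q_cont m d)

theorem u_indep (m d : ℕ) (h : d < m) (y : Fin (d+1) → ℝ) (hy : y ≠ 0) :
    LinearIndependent ℝ ![u m d y, u m d (-y)] := by
  rw [LinearIndependent.pair_iff]
  intro a b hab
  simp only [u, smul_smul] at hab
  obtain ⟨h1, h2⟩ := q_indep m d h y hy _ _ hab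
  have n1 := norm_ne_zero_iff.2 (q_ne m d h y)
  have n2 := norm_ne_zero_iff.2 (q_ne m d h (-y))
  simp only [mul_eq_zero, inv_eq_zero, n1, n2, or_false] at h1 h2
  exact ⟨h1, h2⟩

end BU

theorem stmt_10 (m d : ℕ) (hmd : m > d)
    (W : Set (EuclideanSpace ℝ (Fin (m+1)) × EuclideanSpace ℝ (Fin (m+1))))
    (hW : W = {p | ‖p.1‖ = 1 ∧ ‖p.2‖ = 1 ∧ LinearIndependent ℝ ![p.1, p.2]}) :
    ¬ ∃ g : W → Metric.sphere (0 : EuclideanSpace ℝ (Fin d)) 1,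
        Continuous g ∧
        ∀ p q : W, (q : EuclideanSpace ℝ (Fin (m+1)) × EuclideanSpace ℝ (Fin (m+1)))
            = ((p : EuclideanSpace ℝ (Fin (m+1)) × EuclideanSpace ℝ (Fin (m+1))).2,
               (p : EuclideanSpace ℝ (Fin (m+1)) × EuclideanSpace ℝ (Fin (m+1))).1) →
          g q = -g p := by
  classical
  rintro ⟨g, hg, hodd⟩
  have hmem : ∀ y : Fin (d+1) → ℝ, y ≠ 0 → (BU.u m d y, BU.u m d (-y)) ∈ W := by
    intro y hy
    rw [hW]
    exact ⟨BU.u_norm m d hmd y, BU.u_norm m d hmd _, BU.u_indep m d hmd y hy⟩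
  let G : (Fin (d+1) → ℝ) → (Fin d → ℝ) := fun y =>
    if hy : y ≠ 0 then
      WithLp.ofLp (g ⟨_, hmem y hy⟩ : EuclideanSpace ℝ (Fin d)) else 0
  have hGc : ContinuousOn G {y | y ≠ 0} := by
    rw [continuousOn_iff_continuous_domRestrict]
    have : Set.domRestrict {y | y ≠ 0} G = fun y : {y : Fin (d+1) → ℝ | y ≠ 0} =>
        WithLp.ofLp (g ⟨_, hmem y.1 y.2⟩ : EuclideanSpace ℝ (Fin d)) := by
      funext y
      have : y.1 ≠ 0 := y.2
      exact dif_pos this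
    rw [this]
    apply (PiLp.continuous_ofLp 2 _).comp
    apply continuous_subtype_val.comp
    apply hg.comp
    apply Continuous.subtype_mk
    exact ((BU.u_cont m d hmd).comp continuous_subtype_val).prodMk
      ((BU.u_cont m d hmd).comp continuous_subtype_val.neg)
  have hGo : ∀ y ≠ 0, G (-y) = - G y := by
    intro y hy
    have hy' : -y ≠ 0 := neg_ne_zero.2 hy
    have := hodd ⟨_, hmem y hy⟩ ⟨_, hmem (-y) hy'⟩ (by simp)
    simp only [G, dif_pos hy, dif_pos hy', this]
    simp
  obtain ⟨y, hy, h0⟩ := BU.borsuk_ulam_s10 d G hGc hGo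
  simp only [G, dif_pos hy] at h0
  have h1 : (g ⟨_, hmem y hy⟩ : EuclideanSpace ℝ (Fin d)) = 0 := by
    ext i; exact congrFun h0 i
  have h2 := (g ⟨_, hmem y hy⟩).2
  rw [h1] at h2
  simp at h2
end
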